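/- (Kesten) The critical probability of bond percolation on the square lattice ℤ² equals one half: p_c(ℤ²) = 1/2. In particular θ(p) > 0 for every p > 1/2 and θ(p) = 0 for every p ≤ 1/2. -/

import Mathlib

open MeasureTheory

/-- `e` is an edge of the square lattice `ℤ²`: an unordered pair of vertices at
`ℓ¹`-distance `1`. -/
def IsLatticeEdge (e : Sym2 (ℤ × ℤ)) : Prop :=
  ∃ u v : ℤ × ℤ, e = s(u, v) ∧ |u.1 - v.1| + |u.2 - v.2| = 1

/-- The edges of the square lattice `ℤ²`. -/
def LatticeEdge : Type := {e : Sym2 (ℤ × ℤ) // IsLatticeEdge e}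

/-- A percolation configuration declares each edge of `ℤ²` open (`true`) or closed. -/
abbrev PercConfig : Type := LatticeEdge → Bool

instance : MeasurableSpace PercConfig := MeasurableSpace.pi

/-- `μ` is the product over the edges of `ℤ²` of Bernoulli(`p`) measures: the states of the
edges are independent, each being open with probability `p` and closed with probability
`1 - p`. -/
def IsBernoulliProduct (p : ℝ) (μ : Measure PercConfig) : Prop :=
  ∀ (S : Finset LatticeEdge) (b : LatticeEdge → Bool),
    μ {ω : PercConfig | ∀ e ∈ S, ω e = b e} =
      ∏ e ∈ S, ENNReal.ofReal (if b e then p else 1 - p)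

/-- `u` and `v` are joined by a path of open edges in the configuration `ω`. -/
def OpenConnected (ω : PercConfig) (u v : ℤ × ℤ) : Prop :=
  ∃ (k : ℕ) (x : Fin (k + 1) → ℤ × ℤ), x 0 = u ∧ x (Fin.last k) = v ∧
    ∀ i : Fin k, ∃ h : IsLatticeEdge s(x i.castSucc, x i.succ),
      ω ⟨s(x i.castSucc, x i.succ), h⟩ = true

/-- The open cluster of the origin is infinite. -/
def ClusterInfinite (ω : PercConfig) : Prop :=
  {v : ℤ × ℤ | OpenConnected ω (0, 0) v}.Infinite

namespace Kesten


open Classical in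
noncomputable instance : DecidableEq LatticeEdge := Classical.decEq _

instance : Countable LatticeEdge := inferInstanceAs (Countable {e : Sym2 (ℤ × ℤ) // IsLatticeEdge e})

/-- The configurations which agree with `b` on `S`. -/
def cyl (S : Finset LatticeEdge) (b : PercConfig) : Set PercConfig := {ω | ∀ e ∈ S, ω e = b e}

theorem measurable_eval (e : LatticeEdge) : Measurable (fun ω : PercConfig => ω e) :=
  measurable_pi_apply e

theorem measurableSet_cyl (S : Finset LatticeEdge) (b : PercConfig) : MeasurableSet (cyl S b) := by
  have : cyl S b = ⋂ e ∈ S, (fun ω : PercConfig => ω e) ⁻¹' {b e} := by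
    ext ω; simp [cyl]
  rw [this]
  exact Finset.measurableSet_biInter _ fun e _ => measurable_eval e (measurableSet_singleton _)

theorem isPiSystem_cyl : IsPiSystem {A : Set PercConfig | ∃ S b, A = cyl S b} := by
  rintro _ ⟨S, b, rfl⟩ _ ⟨T, c, rfl⟩ ⟨ω, h1, h2⟩
  refine ⟨S ∪ T, ω, ?_⟩
  ext η
  simp only [cyl, Set.mem_inter_iff, Set.mem_ofPred_eq, Finset.mem_union] at *
  constructor
  · rintro ⟨h3, h4⟩ e (he | he)
    · rw [h3 e he, h1 e he]
    · rw [h4 e he, h2 e he]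
  · intro h
    exact ⟨fun e he => (h e (Or.inl he)).trans (h1 e he), fun e he => (h e (Or.inr he)).trans (h2 e he)⟩

theorem generateFrom_cyl :
    (inferInstance : MeasurableSpace PercConfig) =
      MeasurableSpace.generateFrom {A : Set PercConfig | ∃ S b, A = cyl S b} := by
  apply le_antisymm
  · refine iSup_le fun e => ?_
    rw [← measurable_iff_comap_le]
    refine measurable_to_bool ?_
    apply MeasurableSpace.measurableSet_generateFrom
    refine ⟨{e}, fun _ => true, ?_⟩
    ext ω; simp [cyl]
  · apply MeasurableSpace.generateFrom_le
    rintro _ ⟨S, b, rfl⟩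
    exact measurableSet_cyl S b

theorem bernoulli_unique {p : ℝ} {μ ν : Measure PercConfig} [IsProbabilityMeasure μ]
    [IsProbabilityMeasure ν] (hμ : IsBernoulliProduct p μ) (hν : IsBernoulliProduct p ν) : μ = ν := by
  refine ext_of_generate_finite _ generateFrom_cyl isPiSystem_cyl ?_ (by simp)
  rintro _ ⟨S, b, rfl⟩
  exact (hμ S b).trans (hν S b).symm

/-- Relabelling the edges. -/
def relabel (σ : LatticeEdge ≃ LatticeEdge) (ω : PercConfig) : PercConfig := fun e => ω (σ e)

/-- Relabelling the edges and exchanging open and closed. -/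
def flipRelabel (σ : LatticeEdge ≃ LatticeEdge) (ω : PercConfig) : PercConfig := fun e => !(ω (σ e))

theorem measurable_relabel (σ) : Measurable (relabel σ) :=
  measurable_pi_iff.2 fun e => measurable_eval (σ e)

theorem measurable_flipRelabel (σ) : Measurable (flipRelabel σ) :=
  measurable_pi_iff.2 fun e => (measurable_of_countable (fun b : Bool => !b)).comp (measurable_eval (σ e))

theorem map_relabel {p : ℝ} {μ : Measure PercConfig} [IsProbabilityMeasure μ]
    (hμ : IsBernoulliProduct p μ) (σ : LatticeEdge ≃ LatticeEdge) : μ.map (relabel σ) = μ := by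
  have : IsProbabilityMeasure (μ.map (relabel σ)) :=
    Measure.isProbabilityMeasure_map (measurable_relabel σ).aemeasurable
  refine bernoulli_unique (p := p) ?_ hμ
  intro S b
  change (μ.map (relabel σ)) (cyl S b) = _
  rw [Measure.map_apply (measurable_relabel σ) (measurableSet_cyl S b), cyl]
  have : relabel σ ⁻¹' {ω | ∀ e ∈ S, ω e = b e} =
      {ω | ∀ e ∈ S.map σ.toEmbedding, ω e = (fun e => b (σ.symm e)) e} := by
    ext ω
    simp only [relabel, Set.mem_preimage, Set.mem_ofPred_eq, Finset.mem_map, Equiv.coe_toEmbedding,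
      forall_exists_index, and_imp, forall_apply_eq_imp_iff₂, Equiv.symm_apply_apply]
  rw [this, hμ, Finset.prod_map]
  simp

theorem map_flipRelabel {μ : Measure PercConfig} [IsProbabilityMeasure μ]
    (hμ : IsBernoulliProduct (1 / 2) μ) (σ : LatticeEdge ≃ LatticeEdge) :
    μ.map (flipRelabel σ) = μ := by
  have : IsProbabilityMeasure (μ.map (flipRelabel σ)) :=
    Measure.isProbabilityMeasure_map (measurable_flipRelabel σ).aemeasurable
  refine bernoulli_unique (p := 1 / 2) ?_ hμ
  intro S b
  change (μ.map (flipRelabel σ)) (cyl S b) = _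
  rw [Measure.map_apply (measurable_flipRelabel σ) (measurableSet_cyl S b), cyl]
  have : flipRelabel σ ⁻¹' {ω | ∀ e ∈ S, ω e = b e} =
      {ω | ∀ e ∈ S.map σ.toEmbedding, ω e = (fun e => !(b (σ.symm e))) e} := by
    ext ω
    simp only [flipRelabel, Set.mem_preimage, Set.mem_ofPred_eq, Finset.mem_map, Equiv.coe_toEmbedding,
      forall_exists_index, and_imp, forall_apply_eq_imp_iff₂, Equiv.symm_apply_apply]
    refine forall₂_congr fun e _ => ?_
    cases ω (σ e) <;> cases b e <;> simp
  rw [this, hμ, Finset.prod_map]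
  refine Finset.prod_congr rfl fun e _ => ?_
  simp only [Equiv.coe_toEmbedding, Equiv.symm_apply_apply]
  congr 1
  cases b e <;> norm_num

/-- The event `F` depends only on the edges in `D`. -/
def DepOn (F : Set PercConfig) (D : Set (Sym2 (ℤ × ℤ))) : Prop :=
  ∀ ω ω' : PercConfig, (∀ e : LatticeEdge, e.1 ∈ D → ω e = ω' e) → ω ∈ F → ω' ∈ F

theorem DepOn.mono {F : Set PercConfig} {D D' : Set (Sym2 (ℤ × ℤ))} (h : DepOn F D) (hD : D ⊆ D') :
    DepOn F D' := fun ω ω' hw => h ω ω' fun e he => hw e (hD he)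

theorem DepOn.inter {F G : Set PercConfig} {D : Set (Sym2 (ℤ × ℤ))} (h : DepOn F D)
    (h' : DepOn G D) : DepOn (F ∩ G) D := fun ω ω' hw hm => ⟨h ω ω' hw hm.1, h' ω ω' hw hm.2⟩

theorem DepOn.compl {F : Set PercConfig} {D : Set (Sym2 (ℤ × ℤ))} (h : DepOn F D) :
    DepOn Fᶜ D := fun ω ω' hw hm hn => hm (h ω' ω (fun e he => (hw e he).symm) hn)

theorem depOn_cyl (S : Finset LatticeEdge) (b : PercConfig) {D : Set (Sym2 (ℤ × ℤ))}
    (h : ∀ e ∈ S, e.1 ∈ D) : DepOn (cyl S b) D :=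
  fun _ _ hw hm e he => (hw e (h e he)).symm.trans (hm e he)

open Classical in
/-- The configuration equal to the first one on `D` and to the second one off `D`. -/
noncomputable def glue (D : Set (Sym2 (ℤ × ℤ))) (q : PercConfig × PercConfig) : PercConfig :=
  fun e => if e.1 ∈ D then q.1 e else q.2 e

theorem measurable_glue (D : Set (Sym2 (ℤ × ℤ))) : Measurable (glue D) := by
  refine measurable_pi_iff.2 fun e => ?_
  by_cases h : e.1 ∈ D
  · simpa [glue, h, Function.comp_def] using (measurable_eval e).comp measurable_fst
  · simpa [glue, h, Function.comp_def] using (measurable_eval e).comp measurable_snd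

theorem map_glue {p : ℝ} {μ : Measure PercConfig} [IsProbabilityMeasure μ]
    (hμ : IsBernoulliProduct p μ) (D : Set (Sym2 (ℤ × ℤ))) : (μ.prod μ).map (glue D) = μ := by
  classical
  have : IsProbabilityMeasure ((μ.prod μ).map (glue D)) :=
    Measure.isProbabilityMeasure_map (measurable_glue D).aemeasurable
  refine bernoulli_unique (p := p) ?_ hμ
  intro S b
  change ((μ.prod μ).map (glue D)) (cyl S b) = _
  rw [Measure.map_apply (measurable_glue D) (measurableSet_cyl S b), cyl]
  have : glue D ⁻¹' {ω | ∀ e ∈ S, ω e = b e} =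
      {ω | ∀ e ∈ S.filter (fun e => e.1 ∈ D), ω e = b e} ×ˢ
        {ω | ∀ e ∈ S.filter (fun e => ¬ e.1 ∈ D), ω e = b e} := by
    ext ⟨ω, ω'⟩
    simp only [glue, Set.mem_preimage, Set.mem_ofPred_eq, Finset.mem_filter, Set.mem_prod, and_imp]
    constructor
    · intro h
      refine ⟨fun e he hd => ?_, fun e he hd => ?_⟩
      · simpa [hd] using h e he
      · simpa [hd] using h e he
    · rintro ⟨h1, h2⟩ e he
      split_ifs with hd
      · exact h1 e he hd
      · exact h2 e he hd
  rw [this, Measure.prod_prod, hμ, hμ, Finset.prod_filter_mul_prod_filter_not]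

theorem indep_of_depOn {p : ℝ} {μ : Measure PercConfig} [IsProbabilityMeasure μ]
    (hμ : IsBernoulliProduct p μ) {D : Set (Sym2 (ℤ × ℤ))} {F G : Set PercConfig}
    (hF : DepOn F D) (hG : DepOn G Dᶜ) (mF : MeasurableSet F) (mG : MeasurableSet G) :
    μ.real (F ∩ G) = μ.real F * μ.real G := by
  have h : glue D ⁻¹' (F ∩ G) = F ×ˢ G := by
    ext ⟨ω, ω'⟩
    simp only [Set.mem_preimage, Set.mem_inter_iff, Set.mem_prod]
    have h1 : ∀ e : LatticeEdge, e.1 ∈ D → glue D (ω, ω') e = ω e := fun e he => by simp [glue, he]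
    have h2 : ∀ e : LatticeEdge, e.1 ∈ Dᶜ → glue D (ω, ω') e = ω' e := fun e he => by
      have : e.1 ∉ D := he
      simp [glue, this]
    exact ⟨fun h => ⟨hF _ _ h1 h.1, hG _ _ h2 h.2⟩, fun h =>
      ⟨hF _ _ (fun e he => (h1 e he).symm) h.1, hG _ _ (fun e he => (h2 e he).symm) h.2⟩⟩
  have h2 : μ (F ∩ G) = μ F * μ G := by
    rw [← Measure.prod_prod, ← h, ← Measure.map_apply (measurable_glue D) (mF.inter mG),
      map_glue hμ]
  simp [measureReal_def, h2]

theorem real_cyl {p : ℝ} (hp : p ∈ Set.Ioo (0 : ℝ) 1) {μ : Measure PercConfig}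
    (hμ : IsBernoulliProduct p μ) (S : Finset LatticeEdge) (b : PercConfig) :
    μ.real (cyl S b) = ∏ e ∈ S, if b e then p else 1 - p := by
  rw [measureReal_def, cyl, hμ, ENNReal.toReal_prod]
  refine Finset.prod_congr rfl fun e _ => ENNReal.toReal_ofReal ?_
  split_ifs
  · exact hp.1.le
  · linarith [hp.2]

/-- The configuration whose open edges are those in `T`. -/
noncomputable def conf (T : Finset LatticeEdge) : PercConfig := fun e => decide (e ∈ T)

/-- The expectation of `f` over a random subset of `S`, each element being kept with
probability `p`. -/
noncomputable def Ew (S : Finset LatticeEdge) (p : ℝ) (f : Finset LatticeEdge → ℝ) : ℝ :=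
  ∑ T ∈ S.powerset, (∏ e ∈ S, if e ∈ T then p else 1 - p) * f T

open Classical in
noncomputable def ind (F : Set PercConfig) (T : Finset LatticeEdge) : ℝ := if conf T ∈ F then 1 else 0

theorem real_eq_Ew {p : ℝ} (hp : p ∈ Set.Ioo (0 : ℝ) 1) {μ : Measure PercConfig}
    [IsProbabilityMeasure μ] (hμ : IsBernoulliProduct p μ) {S : Finset LatticeEdge}
    {F : Set PercConfig} (hF : DepOn F (Subtype.val '' (S : Set LatticeEdge))) :
    μ.real F = Ew S p (ind F) := by
  classical
  have hag : ∀ ω : PercConfig, ω ∈ cyl S (conf (S.filter fun e => ω e = true)) := by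
    intro ω e he
    simp [conf, he]
  have hdep : ∀ ω T, ω ∈ cyl S (conf T) → (ω ∈ F ↔ conf T ∈ F) := by
    intro ω T h
    refine ⟨hF _ _ ?_, hF _ _ ?_⟩
    · rintro e ⟨e', he', h'⟩
      obtain rfl := Subtype.ext h'
      exact h _ he'
    · rintro e ⟨e', he', h'⟩
      obtain rfl := Subtype.ext h'
      exact (h _ he').symm
  have hFu : F = ⋃ T ∈ S.powerset.filter (fun T => conf T ∈ F), cyl S (conf T) := by
    ext ω
    simp only [Finset.mem_filter, Finset.mem_powerset, Set.mem_iUnion, exists_prop]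
    constructor
    · intro h
      exact ⟨_, ⟨Finset.filter_subset _ _, (hdep _ _ (hag ω)).1 h⟩, hag ω⟩
    · rintro ⟨T, ⟨_, h⟩, h'⟩
      exact (hdep _ _ h').2 h
  have hd : Set.PairwiseDisjoint (↑(S.powerset.filter (fun T => conf T ∈ F)))
      (fun T => cyl S (conf T)) := by
    intro T hT T' hT' hne
    refine Set.disjoint_left.2 fun ω h h' => hne ?_
    simp only [Finset.coe_filter, Finset.mem_powerset, Set.mem_ofPred_eq] at hT hT'
    ext e
    by_cases he : e ∈ S
    · have := (h e he).symm.trans (h' e he)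
      simpa [conf] using this
    · exact ⟨fun h => absurd (hT.1 h) he, fun h => absurd (hT'.1 h) he⟩
  conv_lhs => rw [hFu]
  rw [measureReal_biUnion_finset hd fun T _ => measurableSet_cyl _ _, Finset.sum_filter, Ew]
  refine Finset.sum_congr rfl fun T _ => ?_
  rw [real_cyl hp hμ]
  by_cases h : conf T ∈ F <;> simp [ind, h, conf]

theorem Ew_insert {S : Finset LatticeEdge} {a : LatticeEdge} (ha : a ∉ S) (p : ℝ)
    (f : Finset LatticeEdge → ℝ) :
    Ew (insert a S) p f = Ew S p (fun T => (1 - p) * f T + p * f (insert a T)) := by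
  unfold Ew
  rw [Finset.sum_powerset_insert ha, ← Finset.sum_add_distrib]
  refine Finset.sum_congr rfl fun T hT => ?_
  have haT : a ∉ T := fun h => ha (Finset.mem_powerset.1 hT h)
  rw [Finset.prod_insert ha, Finset.prod_insert ha]
  have h1 : ∏ e ∈ S, (if e ∈ insert a T then p else 1 - p) = ∏ e ∈ S, (if e ∈ T then p else 1 - p) := by
    refine Finset.prod_congr rfl fun e he => ?_
    have : e ≠ a := fun h => ha (h ▸ he)
    simp [this]
  rw [h1]
  simp [haT]
  ring

theorem Ew_mono {S : Finset LatticeEdge} {p : ℝ} (hp : p ∈ Set.Ioo (0 : ℝ) 1)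
    {f g : Finset LatticeEdge → ℝ} (h : ∀ T, f T ≤ g T) : Ew S p f ≤ Ew S p g := by
  refine Finset.sum_le_sum fun T _ => mul_le_mul_of_nonneg_left (h T) (Finset.prod_nonneg fun e _ => ?_)
  split_ifs
  · exact hp.1.le
  · linarith [hp.2]

theorem Ew_harris {p : ℝ} (hp : p ∈ Set.Ioo (0 : ℝ) 1) (S : Finset LatticeEdge)
    (f g : Finset LatticeEdge → ℝ) (hf : Monotone f) (hg : Monotone g) :
    Ew S p f * Ew S p g ≤ Ew S p (fun T => f T * g T) := by
  induction S using Finset.induction_on generalizing f g with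
  | empty => simp [Ew]
  | insert a S ha ih =>
    rw [Ew_insert ha, Ew_insert ha, Ew_insert ha]
    have hm : ∀ f : Finset LatticeEdge → ℝ, Monotone f →
        Monotone fun T => (1 - p) * f T + p * f (insert a T) := by
      intro f hf T T' h
      have h1 := mul_le_mul_of_nonneg_left (hf h) (by linarith [hp.2] : 0 ≤ 1 - p)
      have h2 := mul_le_mul_of_nonneg_left (hf (Finset.insert_subset_insert a h)) hp.1.le
      simp only at h1 h2 ⊢
      linarith
    refine (ih _ _ (hm f hf) (hm g hg)).trans (Ew_mono hp fun T => ?_)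
    have h1 := hf (Finset.subset_insert a T)
    have h2 := hg (Finset.subset_insert a T)
    have h3 : 0 ≤ p * (1 - p) * ((f (insert a T) - f T) * (g (insert a T) - g T)) :=
      mul_nonneg (mul_nonneg hp.1.le (by linarith [hp.2]))
        (mul_nonneg (sub_nonneg.2 h1) (sub_nonneg.2 h2))
    nlinarith


theorem isLatticeEdge_mk {u v : ℤ × ℤ} :
    IsLatticeEdge s(u, v) ↔ |u.1 - v.1| + |u.2 - v.2| = 1 := by
  constructor
  · rintro ⟨a, b, h, h'⟩
    rcases Sym2.eq_iff.1 h with ⟨rfl, rfl⟩ | ⟨rfl, rfl⟩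
    · exact h'
    · rwa [abs_sub_comm, abs_sub_comm u.2]
  · exact fun h => ⟨u, v, rfl, h⟩

theorem isLatticeEdge_cases {u v : ℤ × ℤ} (h : IsLatticeEdge s(u, v)) :
    v = (u.1 + 1, u.2) ∨ u = (v.1 + 1, v.2) ∨ v = (u.1, u.2 + 1) ∨ u = (v.1, v.2 + 1) := by
  rw [isLatticeEdge_mk] at h
  obtain ⟨a, b⟩ := u
  obtain ⟨c, d⟩ := v
  simp only [Prod.mk.injEq] at *
  rcases abs_cases (a - c) with h1 | h1 <;> rcases abs_cases (b - d) with h2 | h2 <;> omega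

/-- The edge between `u` and `v` is present and open. -/
def Op (ω : PercConfig) (u v : ℤ × ℤ) : Prop := ∃ h : IsLatticeEdge s(u, v), ω ⟨s(u, v), h⟩ = true

/-- An open step along an edge of `D`. -/
def Step (ω : PercConfig) (D : Set (Sym2 (ℤ × ℤ))) (a b : ℤ × ℤ) : Prop := Op ω a b ∧ s(a, b) ∈ D

/-- Connection by an open path using only edges of `D`. -/
def Conn (ω : PercConfig) (D : Set (Sym2 (ℤ × ℤ))) (u v : ℤ × ℤ) : Prop :=
  Relation.ReflTransGen (Step ω D) u v

section Conn

variable {ω ω' : PercConfig} {D D' : Set (Sym2 (ℤ × ℤ))} {u v w : ℤ × ℤ}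

theorem Op.symm (h : Op ω u v) : Op ω v u := by
  obtain ⟨h, h'⟩ := h
  have e : s(u, v) = s(v, u) := Sym2.eq_swap
  refine ⟨e ▸ h, ?_⟩
  rw [← h']
  congr 2
  exact e.symm

theorem Op.cases (h : Op ω u v) :
    v = (u.1 + 1, u.2) ∨ u = (v.1 + 1, v.2) ∨ v = (u.1, u.2 + 1) ∨ u = (v.1, v.2 + 1) :=
  isLatticeEdge_cases h.1

theorem Op.mono (h : ∀ e, ω e = true → ω' e = true) (hu : Op ω u v) : Op ω' u v :=
  ⟨hu.1, h _ hu.2⟩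

theorem Step.symm (h : Step ω D u v) : Step ω D v u :=
  ⟨h.1.symm, Sym2.eq_swap (a := u) (b := v) ▸ h.2⟩

theorem Conn.refl (ω : PercConfig) (D : Set (Sym2 (ℤ × ℤ))) (u : ℤ × ℤ) : Conn ω D u u :=
  Relation.ReflTransGen.refl

theorem Conn.trans (h : Conn ω D u v) (h' : Conn ω D v w) : Conn ω D u w :=
  Relation.ReflTransGen.trans h h'

theorem Conn.tail (h : Conn ω D u v) (h' : Op ω v w) (h2 : s(v, w) ∈ D) : Conn ω D u w :=
  Relation.ReflTransGen.tail h ⟨h', h2⟩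

theorem Conn.single (h' : Op ω v w) (h2 : s(v, w) ∈ D) : Conn ω D v w :=
  Relation.ReflTransGen.single ⟨h', h2⟩

theorem Conn.symm (h : Conn ω D u v) : Conn ω D v u := by
  induction h with
  | refl => exact Conn.refl _ _ _
  | tail _ h' ih => exact Relation.ReflTransGen.head h'.symm ih

theorem Conn.mono_of (h : ∀ a b, Step ω D a b → Step ω' D' a b) (hu : Conn ω D u v) :
    Conn ω' D' u v := Relation.ReflTransGen.mono h _ _ hu

theorem Conn.mono_set (h : D ⊆ D') (hu : Conn ω D u v) : Conn ω D' u v :=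
  hu.mono_of fun _ _ hs => ⟨hs.1, h hs.2⟩

theorem Conn.mono (h : ∀ e, ω e = true → ω' e = true) (hu : Conn ω D u v) : Conn ω' D u v :=
  hu.mono_of fun _ _ hs => ⟨hs.1.mono h, hs.2⟩

theorem Conn.congr (h : ∀ e : LatticeEdge, e.1 ∈ D → ω e = ω' e) (hu : Conn ω D u v) :
    Conn ω' D u v :=
  hu.mono_of fun _ _ hs => ⟨⟨hs.1.1, (h _ hs.2).symm.trans hs.1.2⟩, hs.2⟩

theorem openConnected_iff : OpenConnected ω u v ↔ Conn ω Set.univ u v := by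
  constructor
  · rintro ⟨k, x, rfl, rfl, h⟩
    have : ∀ j : Fin (k + 1), Conn ω Set.univ (x 0) (x j) := by
      intro j
      induction j using Fin.induction with
      | zero => exact Conn.refl _ _ _
      | succ i ih => exact ih.tail (h i) trivial
    exact this _
  · intro h
    induction h with
    | refl => exact ⟨0, fun _ => u, rfl, rfl, fun i => i.elim0⟩
    | @tail b c _ hs ih =>
      obtain ⟨k, x, h0, hl, hx⟩ := ih
      refine ⟨k + 1, Fin.snoc x c, ?_, by simp, fun i => ?_⟩
      · rw [← h0, ← Fin.castSucc_zero, Fin.snoc_castSucc]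
      · induction i using Fin.lastCases with
        | last =>
          have : Op ω (x (Fin.last k)) c := hl ▸ hs.1
          simpa [Op] using this
        | cast i =>
          have : Op ω (x i.castSucc) (x i.succ) := hx i
          have e1 : (Fin.snoc x c : Fin (k + 2) → ℤ × ℤ) i.castSucc.castSucc = x i.castSucc :=
            Fin.snoc_castSucc (α := fun _ => ℤ × ℤ) _ _ _
          have e2 : (Fin.snoc x c : Fin (k + 2) → ℤ × ℤ) i.castSucc.succ = x i.succ := by
            rw [Fin.succ_castSucc]
            exact Fin.snoc_castSucc (α := fun _ => ℤ × ℤ) _ _ _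
          change Op ω _ _
          rw [e1, e2]
          exact this

end Conn

/-- Edges with at least one endpoint in `U`. -/
def touch (U : Set (ℤ × ℤ)) : Set (Sym2 (ℤ × ℤ)) := {e | ∃ v ∈ e, v ∈ U}

/-- Edges with both endpoints in `U`. -/
def inside (U : Set (ℤ × ℤ)) : Set (Sym2 (ℤ × ℤ)) := {e | ∀ v ∈ e, v ∈ U}

theorem mem_touch {U : Set (ℤ × ℤ)} {u v : ℤ × ℤ} : s(u, v) ∈ touch U ↔ u ∈ U ∨ v ∈ U := by
  simp [touch, -Prod.exists]

theorem mem_inside {U : Set (ℤ × ℤ)} {u v : ℤ × ℤ} : s(u, v) ∈ inside U ↔ u ∈ U ∧ v ∈ U := by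
  simp [inside, -Prod.forall]

theorem inside_subset_touch {U : Set (ℤ × ℤ)} : inside U ⊆ touch U := by
  intro e
  induction e using Sym2.ind with
  | _ u v =>
    rw [mem_touch, mem_inside]
    exact fun h => Or.inl h.1

theorem touch_mono {U U' : Set (ℤ × ℤ)} (h : U ⊆ U') : touch U ⊆ touch U' :=
  fun _ ⟨v, hv, hu⟩ => ⟨v, hv, h hu⟩

theorem Conn.exit {ω : PercConfig} {D : Set (Sym2 (ℤ × ℤ))} {u v : ℤ × ℤ} {U : Set (ℤ × ℤ)}
    (h : Conn ω D u v) (hu : u ∈ U) (hv : v ∉ U) :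
    ∃ x ∈ U, ∃ y ∉ U, Conn ω (D ∩ inside U) u x ∧ Op ω x y ∧ s(x, y) ∈ D ∧ Conn ω D y v := by
  induction h using Relation.ReflTransGen.head_induction_on with
  | refl => exact absurd hu hv
  | @head a c h' h ih =>
    by_cases hc : c ∈ U
    · obtain ⟨x, hx, y, hy, h1, h2⟩ := ih hc
      refine ⟨x, hx, y, hy, Relation.ReflTransGen.head ⟨h'.1, h'.2, ?_⟩ h1, h2⟩
      exact mem_inside.2 ⟨hu, hc⟩
    · exact ⟨a, hu, c, hc, Conn.refl _ _ _, h'.1, h'.2, h⟩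

/-- There is an open path using edges touching `U` from `X` to `Y`. -/
def Arm (X U Y : Set (ℤ × ℤ)) : Set PercConfig :=
  {ω | ∃ u ∈ X, ∃ y ∈ Y, Conn ω (touch U) u y}

/-- Events witnessed by finitely many open edges. -/
def Witnessed (F : Set PercConfig) : Prop :=
  ∀ ω ∈ F, ∃ K : Finset LatticeEdge, (∀ e ∈ K, ω e = true) ∧
    ∀ ω' : PercConfig, (∀ e ∈ K, ω' e = true) → ω' ∈ F

theorem Witnessed.mono {F : Set PercConfig} (h : Witnessed F) {ω ω' : PercConfig}
    (hw : ∀ e, ω e = true → ω' e = true) (hF : ω ∈ F) : ω' ∈ F := by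
  obtain ⟨K, h1, h2⟩ := h ω hF
  exact h2 _ fun e he => hw e (h1 e he)

theorem Witnessed.measurableSet {F : Set PercConfig} (h : Witnessed F) : MeasurableSet F := by
  have : F = ⋃ K ∈ {K : Finset LatticeEdge | cyl K (fun _ => true) ⊆ F}, cyl K (fun _ => true) := by
    ext ω
    simp only [Set.mem_iUnion, exists_prop]
    constructor
    · intro hF
      obtain ⟨K, h1, h2⟩ := h ω hF
      exact ⟨K, fun ω' hw => h2 ω' hw, h1⟩
    · rintro ⟨K, h1, h2⟩
      exact h1 h2
  rw [this]
  exact MeasurableSet.biUnion (Set.to_countable _) fun K _ => measurableSet_cyl _ _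

theorem Witnessed.iUnion {ι : Sort*} {F : ι → Set PercConfig} (h : ∀ i, Witnessed (F i)) :
    Witnessed (⋃ i, F i) := by
  intro ω hw
  obtain ⟨i, hi⟩ := Set.mem_iUnion.1 hw
  obtain ⟨K, h1, h2⟩ := h i ω hi
  exact ⟨K, h1, fun ω' h' => Set.mem_iUnion.2 ⟨i, h2 ω' h'⟩⟩

theorem Witnessed.inter {F G : Set PercConfig} (h : Witnessed F) (h' : Witnessed G) :
    Witnessed (F ∩ G) := by
  intro ω hw
  obtain ⟨K, h1, h2⟩ := h ω hw.1
  obtain ⟨K', h1', h2'⟩ := h' ω hw.2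
  refine ⟨K ∪ K', fun e he => ?_, fun ω' hh => ⟨h2 _ fun e he => hh e ?_, h2' _ fun e he => hh e ?_⟩⟩
  · rcases Finset.mem_union.1 he with he | he
    exacts [h1 e he, h1' e he]
  · exact Finset.mem_union_left _ he
  · exact Finset.mem_union_right _ he

theorem witnessed_conn (D : Set (Sym2 (ℤ × ℤ))) (u v : ℤ × ℤ) : Witnessed {ω | Conn ω D u v} := by
  intro ω hw
  induction hw with
  | refl => exact ⟨∅, by simp, fun ω' _ => Conn.refl _ _ _⟩
  | @tail b c _ hs ih =>
    obtain ⟨K, h1, h2⟩ := ih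
    refine ⟨insert ⟨_, hs.1.1⟩ K, fun e he => ?_, fun ω' hh => ?_⟩
    · rcases Finset.mem_insert.1 he with rfl | he
      exacts [hs.1.2, h1 e he]
    · exact (h2 ω' fun e he => hh e (Finset.mem_insert_of_mem he)).tail
        ⟨hs.1.1, hh _ (Finset.mem_insert_self _ _)⟩ hs.2

theorem witnessed_arm (X U Y : Set (ℤ × ℤ)) : Witnessed (Arm X U Y) := by
  have : Arm X U Y = ⋃ u, ⋃ (_ : u ∈ X), ⋃ y, ⋃ (_ : y ∈ Y), {ω | Conn ω (touch U) u y} := by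
    ext ω; simp [Arm]
  rw [this]
  exact Witnessed.iUnion fun u => Witnessed.iUnion fun _ => Witnessed.iUnion fun y =>
    Witnessed.iUnion fun _ => witnessed_conn _ _ _

theorem witnessed_open (S : Finset LatticeEdge) : Witnessed (cyl S fun _ => true) :=
  fun _ hw => ⟨S, hw, fun _ h => h⟩

theorem depOn_arm (X U Y : Set (ℤ × ℤ)) : DepOn (Arm X U Y) (touch U) := by
  rintro ω ω' h ⟨u, hu, y, hy, hw⟩
  exact ⟨u, hu, y, hy, hw.congr h⟩

theorem Arm.mono {X X' U U' Y Y' : Set (ℤ × ℤ)} (hX : X ⊆ X') (hU : U ⊆ U') (hY : Y ⊆ Y') :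
    Arm X U Y ⊆ Arm X' U' Y' := by
  rintro ω ⟨u, hu, y, hy, h⟩
  exact ⟨u, hX hu, y, hY hy, h.mono_set (touch_mono hU)⟩

section Harris

variable {p : ℝ} {μ : Measure PercConfig} [IsProbabilityMeasure μ]

theorem ind_mono {F : Set PercConfig} (hF : ∀ ω ω' : PercConfig, (∀ e, ω e = true → ω' e = true) →
    ω ∈ F → ω' ∈ F) : Monotone (ind F) := by
  intro T T' h
  unfold ind
  split_ifs with h1 h2 h2
  · exact le_rfl
  · exact absurd (hF (conf T) (conf T') (fun e he => by simp [conf] at he ⊢; exact h he) h1) h2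
  · exact zero_le_one
  · exact le_rfl

theorem harris_finite (hp : p ∈ Set.Ioo (0 : ℝ) 1) (hμ : IsBernoulliProduct p μ)
    {S : Finset LatticeEdge} {F G : Set PercConfig}
    (hF : DepOn F (Subtype.val '' (S : Set LatticeEdge)))
    (hG : DepOn G (Subtype.val '' (S : Set LatticeEdge)))
    (mF : ∀ ω ω' : PercConfig, (∀ e, ω e = true → ω' e = true) → ω ∈ F → ω' ∈ F)
    (mG : ∀ ω ω' : PercConfig, (∀ e, ω e = true → ω' e = true) → ω ∈ G → ω' ∈ G) :
    μ.real F * μ.real G ≤ μ.real (F ∩ G) := by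
  rw [real_eq_Ew hp hμ hF, real_eq_Ew hp hμ hG, real_eq_Ew hp hμ (hF.inter hG)]
  have : ind (F ∩ G) = fun T => ind F T * ind G T := by
    ext T
    by_cases h1 : conf T ∈ F <;> by_cases h2 : conf T ∈ G <;> simp [ind, h1, h2]
  rw [this]
  exact Ew_harris hp S _ _ (ind_mono mF) (ind_mono mG)

/-- The configurations whose restriction to `S` is in `F`. -/
def restr (F : Set PercConfig) (S : Finset LatticeEdge) : Set PercConfig :=
  {ω | conf (S.filter fun e => ω e = true) ∈ F}

theorem depOn_restr (F : Set PercConfig) (S : Finset LatticeEdge) :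
    DepOn (restr F S) (Subtype.val '' (S : Set LatticeEdge)) := by
  intro ω ω' h hw
  have : (S.filter fun e => ω' e = true) = S.filter fun e => ω e = true :=
    Finset.filter_congr fun e he => by rw [h e ⟨e, he, rfl⟩]
  simpa [restr, this] using hw

theorem Witnessed.iUnion_restr {F : Set PercConfig} (h : Witnessed F) : ⋃ S, restr F S = F := by
  ext ω
  simp only [Set.mem_iUnion]
  constructor
  · rintro ⟨S, hS⟩
    exact h.mono (fun e he => by simp [conf] at he; exact he.2) hS
  · intro hw
    obtain ⟨K, h1, h2⟩ := h ω hw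
    exact ⟨K, h2 _ fun e he => by simp [conf, he, h1 e he]⟩

theorem Witnessed.restr_mono {F : Set PercConfig} (h : Witnessed F) : Monotone (restr F) := by
  intro S T hST ω hw
  refine h.mono (fun e he => ?_) hw
  simp [conf] at he ⊢
  exact ⟨hST he.1, he.2⟩

theorem Witnessed.tendsto_restr {F : Set PercConfig} (h : Witnessed F) :
    Filter.Tendsto (fun S => μ.real (restr F S)) Filter.atTop (nhds (μ.real F)) := by
  have := tendsto_measure_iUnion_atTop (μ := μ) h.restr_mono
  rw [h.iUnion_restr] at this
  exact (ENNReal.tendsto_toReal (measure_ne_top _ _)).comp this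

theorem harris (hp : p ∈ Set.Ioo (0 : ℝ) 1) (hμ : IsBernoulliProduct p μ) {F G : Set PercConfig}
    (hF : Witnessed F) (hG : Witnessed G) : μ.real F * μ.real G ≤ μ.real (F ∩ G) := by
  refine le_of_tendsto_of_tendsto' (hF.tendsto_restr.mul hG.tendsto_restr)
    (hF.inter hG).tendsto_restr fun S => ?_
  have hm : ∀ F : Set PercConfig, Witnessed F → ∀ ω ω' : PercConfig,
      (∀ e, ω e = true → ω' e = true) → ω ∈ restr F S → ω' ∈ restr F S := by
    intro F h ω ω' hw
    refine h.mono fun e he => ?_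
    simp [conf] at he ⊢
    exact ⟨he.1, hw e he.2⟩
  exact harris_finite hp hμ (depOn_restr F S) (depOn_restr G S) (hm F hF) (hm G hG)

end Harris

/-- A lattice automorphism acting on the edges. -/
def edgeMap (τ : ℤ × ℤ ≃ ℤ × ℤ)
    (hτ : ∀ u v, IsLatticeEdge s(τ u, τ v) ↔ IsLatticeEdge s(u, v)) : LatticeEdge ≃ LatticeEdge where
  toFun e := ⟨Sym2.map τ e.1, by
    obtain ⟨e, he⟩ := e
    induction e using Sym2.ind with
    | _ u v => exact (hτ u v).2 he⟩
  invFun e := ⟨Sym2.map τ.symm e.1, by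
    obtain ⟨e, he⟩ := e
    induction e using Sym2.ind with
    | _ u v =>
      have := hτ (τ.symm u) (τ.symm v)
      simp only [Equiv.apply_symm_apply] at this
      exact this.1 he⟩
  left_inv e := by
    apply Subtype.ext
    simp [Sym2.map_map]
  right_inv e := by
    apply Subtype.ext
    simp [Sym2.map_map]

section Symmetry

variable {τ : ℤ × ℤ ≃ ℤ × ℤ} {hτ : ∀ u v, IsLatticeEdge s(τ u, τ v) ↔ IsLatticeEdge s(u, v)}
  {ω : PercConfig}

theorem op_relabel {u v : ℤ × ℤ} : Op (relabel (edgeMap τ hτ) ω) u v ↔ Op ω (τ u) (τ v) :=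
  ⟨fun h => ⟨(hτ u v).2 h.1, h.2⟩, fun h => ⟨(hτ u v).1 h.1, h.2⟩⟩

theorem conn_relabel {D : Set (Sym2 (ℤ × ℤ))} {u v : ℤ × ℤ} :
    Conn (relabel (edgeMap τ hτ) ω) (Sym2.map τ ⁻¹' D) u v ↔ Conn ω D (τ u) (τ v) := by
  constructor
  · exact fun h => Relation.ReflTransGen.lift τ (fun a b hs => ⟨op_relabel.1 hs.1, hs.2⟩) _ _ h
  · intro h
    have := Relation.ReflTransGen.lift (p := Step (relabel (edgeMap τ hτ) ω) (Sym2.map τ ⁻¹' D))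
      τ.symm (fun a b hs => ?_) _ _ h
    · simpa [Function.onFun, Conn] using this
    · refine ⟨op_relabel.2 (by simpa using hs.1), ?_⟩
      simpa using hs.2

theorem map_preimage_touch (U : Set (ℤ × ℤ)) : Sym2.map τ ⁻¹' touch U = touch (τ ⁻¹' U) := by
  ext e
  induction e using Sym2.ind with
  | _ u v => simp only [Set.mem_preimage, Sym2.map_mk, mem_touch]

theorem arm_relabel {X U Y : Set (ℤ × ℤ)} :
    relabel (edgeMap τ hτ) ω ∈ Arm (τ ⁻¹' X) (τ ⁻¹' U) (τ ⁻¹' Y) ↔ ω ∈ Arm X U Y := by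
  simp only [Arm, Set.mem_ofPred_eq, ← map_preimage_touch, conn_relabel]
  constructor
  · rintro ⟨u, hu, y, hy, h⟩
    exact ⟨τ u, hu, τ y, hy, h⟩
  · rintro ⟨u, hu, y, hy, h⟩
    exact ⟨τ.symm u, by simpa using hu, τ.symm y, by simpa using hy, by simpa using h⟩

theorem real_relabel {p : ℝ} {μ : Measure PercConfig} [IsProbabilityMeasure μ]
    (hμ : IsBernoulliProduct p μ) (σ : LatticeEdge ≃ LatticeEdge) {F : Set PercConfig}
    (hF : MeasurableSet F) : μ.real {ω | relabel σ ω ∈ F} = μ.real F := by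
  conv_rhs => rw [← map_relabel hμ σ]
  rw [map_measureReal_apply (measurable_relabel σ) hF]
  rfl

theorem real_arm_preimage {p : ℝ} {μ : Measure PercConfig} [IsProbabilityMeasure μ]
    (hμ : IsBernoulliProduct p μ) (hτ : ∀ u v, IsLatticeEdge s(τ u, τ v) ↔ IsLatticeEdge s(u, v))
    (X U Y : Set (ℤ × ℤ)) :
    μ.real (Arm (τ ⁻¹' X) (τ ⁻¹' U) (τ ⁻¹' Y)) = μ.real (Arm X U Y) := by
  rw [← real_relabel hμ (edgeMap τ hτ) (witnessed_arm _ _ _).measurableSet]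
  congr 1
  ext ω
  exact arm_relabel

end Symmetry

/-- Translation by `a`. -/
def shift (a : ℤ × ℤ) : ℤ × ℤ ≃ ℤ × ℤ := Equiv.addRight a

theorem shift_edge (a u v : ℤ × ℤ) :
    IsLatticeEdge s(shift a u, shift a v) ↔ IsLatticeEdge s(u, v) := by
  simp [isLatticeEdge_mk, shift]

/-- The reflection `x ↦ -x`. -/
def reflX : ℤ × ℤ ≃ ℤ × ℤ := (Equiv.neg ℤ).prodCongr (Equiv.refl ℤ)

theorem reflX_edge (u v : ℤ × ℤ) : IsLatticeEdge s(reflX u, reflX v) ↔ IsLatticeEdge s(u, v) := by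
  simp [isLatticeEdge_mk, reflX, ← abs_neg (u.1 - v.1)]
  rw [show -u.1 + v.1 = v.1 - u.1 by ring]

/-- The reflection `y ↦ -s - y`. -/
def reflY (s : ℤ) : ℤ × ℤ ≃ ℤ × ℤ := (Equiv.refl ℤ).prodCongr (Equiv.subLeft (-s))

theorem reflY_edge (t : ℤ) (u v : ℤ × ℤ) :
    IsLatticeEdge s(reflY t u, reflY t v) ↔ IsLatticeEdge s(u, v) := by
  simp [isLatticeEdge_mk, reflY, ← abs_neg (u.2 - v.2)]

theorem swap_edge (u v : ℤ × ℤ) :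
    IsLatticeEdge s(Equiv.prodComm ℤ ℤ u, Equiv.prodComm ℤ ℤ v) ↔ IsLatticeEdge s(u, v) := by
  simp [isLatticeEdge_mk, add_comm]

/-- The horizontal edge with left endpoint `v`. -/
def hE (v : ℤ × ℤ) : LatticeEdge := ⟨s(v, (v.1 + 1, v.2)), isLatticeEdge_mk.2 (by simp)⟩

/-- The vertical edge with lower endpoint `v`. -/
def vE (v : ℤ × ℤ) : LatticeEdge := ⟨s(v, (v.1, v.2 + 1)), isLatticeEdge_mk.2 (by simp)⟩

theorem op_right {ω : PercConfig} {x y : ℤ} : Op ω (x, y) (x + 1, y) ↔ ω (hE (x, y)) = true :=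
  ⟨fun h => h.2, fun h => ⟨(hE (x, y)).2, h⟩⟩

theorem op_up {ω : PercConfig} {x y : ℤ} : Op ω (x, y) (x, y + 1) ↔ ω (vE (x, y)) = true :=
  ⟨fun h => h.2, fun h => ⟨(vE (x, y)).2, h⟩⟩

/-- The edge with a given lower left endpoint and direction. -/
def toEdge : (ℤ × ℤ) × Bool → LatticeEdge
  | (v, false) => hE v
  | (v, true) => vE v

theorem toEdge_bijective : Function.Bijective toEdge := by
  constructor
  · rintro ⟨⟨a, b⟩, c⟩ ⟨⟨a', b'⟩, c'⟩ h
    have := congrArg Subtype.val h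
    cases c <;> cases c' <;> simp [toEdge, hE, vE] at this ⊢ <;> omega
  · rintro ⟨e, he⟩
    induction e using Sym2.ind with
    | _ u v =>
      rcases isLatticeEdge_cases he with rfl | rfl | rfl | rfl
      · exact ⟨(u, false), rfl⟩
      · exact ⟨(v, false), Subtype.ext Sym2.eq_swap⟩
      · exact ⟨(u, true), rfl⟩
      · exact ⟨(v, true), Subtype.ext Sym2.eq_swap⟩

/-- The lattice edges indexed by lower left endpoint and direction. -/
noncomputable def edgeEquiv : (ℤ × ℤ) × Bool ≃ LatticeEdge := Equiv.ofBijective _ toEdge_bijective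

/-- Each edge of the dual lattice crosses one primal edge. The dual vertex `(a, b)` is placed at
`(a + 1/2, b + 1/2)`. -/
def crossIndex : (ℤ × ℤ) × Bool ≃ (ℤ × ℤ) × Bool where
  toFun
    | ((a, b), false) => ((a + 1, b), true)
    | ((a, b), true) => ((a, b + 1), false)
  invFun
    | ((a, b), true) => ((a - 1, b), false)
    | ((a, b), false) => ((a, b - 1), true)
  left_inv := by rintro ⟨⟨a, b⟩, c⟩; cases c <;> simp
  right_inv := by rintro ⟨⟨a, b⟩, c⟩; cases c <;> simp

/-- The primal edge crossed by a dual edge. -/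
noncomputable def cross : LatticeEdge ≃ LatticeEdge := (edgeEquiv.symm.trans crossIndex).trans edgeEquiv

theorem cross_hE (a b : ℤ) : cross (hE (a, b)) = vE (a + 1, b) := by
  have : hE (a, b) = edgeEquiv ((a, b), false) := rfl
  simp [cross, this]
  rfl

theorem cross_vE (a b : ℤ) : cross (vE (a, b)) = hE (a, b + 1) := by
  have : vE (a, b) = edgeEquiv ((a, b), true) := rfl
  simp [cross, this]
  rfl

/-- The dual configuration. -/
noncomputable def dual (ω : PercConfig) : PercConfig := flipRelabel cross ω

theorem dual_hE {ω : PercConfig} {a b : ℤ} : dual ω (hE (a, b)) = !ω (vE (a + 1, b)) := by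
  rw [dual, flipRelabel, cross_hE]

theorem dual_vE {ω : PercConfig} {a b : ℤ} : dual ω (vE (a, b)) = !ω (hE (a, b + 1)) := by
  rw [dual, flipRelabel, cross_vE]

theorem real_dual {μ : Measure PercConfig} [IsProbabilityMeasure μ]
    (hμ : IsBernoulliProduct (1 / 2) μ) {F : Set PercConfig}
    (hF : MeasurableSet F) : μ.real {ω | dual ω ∈ F} = μ.real F := by
  conv_rhs => rw [← map_flipRelabel hμ cross]
  rw [map_measureReal_apply (measurable_flipRelabel cross) hF]
  rfl


/-- The box of radius `N`. -/
def box (N : ℕ) : Set (ℤ × ℤ) := {v | |v.1| ≤ N ∧ |v.2| ≤ N}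

theorem box_finite (N : ℕ) : (box N).Finite := by
  refine (Set.toFinite (Set.Icc (-(N : ℤ)) N ×ˢ Set.Icc (-(N : ℤ)) N)).subset ?_
  rintro ⟨a, b⟩ ⟨h1, h2⟩
  exact ⟨abs_le.1 h1, abs_le.1 h2⟩

theorem exists_box {S : Set (ℤ × ℤ)} (hS : S.Finite) : ∃ N, S ⊆ box N := by
  induction S, hS using Set.Finite.induction_on with
  | empty => exact ⟨0, Set.empty_subset _⟩
  | @insert a S _ _ ih =>
    obtain ⟨N, hN⟩ := ih
    refine ⟨N + a.1.natAbs + a.2.natAbs, Set.insert_subset ?_ fun v hv => ?_⟩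
    · have h1 := abs_nonneg a.1
      have h2 := abs_nonneg a.2
      constructor <;> push_cast <;> omega
    · have := hN hv
      have h1 := abs_nonneg a.1
      have h2 := abs_nonneg a.2
      constructor <;> [have := this.1; have := this.2] <;> push_cast <;> omega

/-- The vertex `v` is joined to the complement of the box of radius `N` around it. -/
def Far (N : ℕ) (v : ℤ × ℤ) : Set PercConfig :=
  {ω | ∃ y, y - v ∉ box N ∧ Conn ω Set.univ v y}

theorem zero_mem_box (N : ℕ) : (0 : ℤ × ℤ) ∈ box N := by simp [box]

theorem exists_conn_touch {ω : PercConfig} {X U : Set (ℤ × ℤ)} (hX : X ⊆ U) :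
    ω ∈ Arm X U Uᶜ ↔ ∃ x ∈ X, ∃ y ∉ U, Conn ω Set.univ x y := by
  constructor
  · rintro ⟨u, hu, y, hy, h⟩
    exact ⟨u, hu, y, hy, h.mono_set (Set.subset_univ _)⟩
  · rintro ⟨u, hu, y, hy, h⟩
    obtain ⟨a, ha, b, hb, h1, h2, _⟩ := h.exit (hX hu) hy
    exact ⟨u, hu, b, hb, (h1.mono_set (Set.inter_subset_right.trans inside_subset_touch)).tail h2
      (mem_touch.2 (Or.inl ha))⟩

theorem far_zero (N : ℕ) : Far N 0 = Arm {0} (box N) (box N)ᶜ := by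
  ext ω
  rw [exists_conn_touch (Set.singleton_subset_iff.2 (zero_mem_box N))]
  simp [Far, -Prod.exists]

theorem witnessed_far (N : ℕ) (v : ℤ × ℤ) : Witnessed (Far N v) := by
  have : Far N v = ⋃ y, ⋃ (_ : y - v ∉ box N), {ω | Conn ω Set.univ v y} := by
    ext ω; simp [Far]
  rw [this]
  exact Witnessed.iUnion fun y => Witnessed.iUnion fun _ => witnessed_conn _ _ _

theorem far_antitone : Antitone fun N => Far N 0 := by
  rintro N M h ω ⟨y, hy, hc⟩
  refine ⟨y, fun hb => hy ?_, hc⟩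
  have : (N : ℤ) ≤ M := by exact_mod_cast h
  exact ⟨hb.1.trans this, hb.2.trans this⟩

theorem clusterInfinite_iff {ω : PercConfig} : ClusterInfinite ω ↔ ∀ N, ω ∈ Far N 0 := by
  simp only [ClusterInfinite, openConnected_iff]
  constructor
  · intro h N
    obtain ⟨y, hy, hN⟩ := h.exists_notMem_finite (box_finite N)
    exact ⟨y, by simpa using hN, hy⟩
  · intro h hf
    obtain ⟨N, hN⟩ := exists_box (Set.not_infinite.1 (not_not.2 hf))
    obtain ⟨y, hy, hc⟩ := h N
    exact hy (by simpa using hN hc)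

theorem real_far {p : ℝ} {μ : Measure PercConfig} [IsProbabilityMeasure μ]
    (hμ : IsBernoulliProduct p μ) (N : ℕ) (v : ℤ × ℤ) : μ.real (Far N v) = μ.real (Far N 0) := by
  rw [← real_relabel hμ (edgeMap (shift v) (shift_edge v)) (witnessed_far N 0).measurableSet]
  congr 1
  ext ω
  have hc : ∀ y, Conn (relabel (edgeMap (shift v) (shift_edge v)) ω) Set.univ 0 y ↔
      Conn ω Set.univ v (y + v) := by
    intro y
    have := conn_relabel (τ := shift v) (hτ := shift_edge v) (ω := ω) (D := Set.univ) (u := 0) (v := y)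
    simpa [shift] using this
  constructor
  · rintro ⟨y, hy, h⟩
    exact ⟨y - v, by simpa using hy, (hc _).2 (by simpa using h)⟩
  · rintro ⟨y, hy, h⟩
    exact ⟨y + v, by simpa using hy, (hc _).1 h⟩

section Crossing

variable {ω : PercConfig}

theorem sum_range_charTwo (t : ℕ → ZMod 2) (n : ℕ) :
    ∑ j ∈ Finset.range n, (t j + t (j + 1)) = t 0 + t n := by
  have : ∀ j, t j + t (j + 1) = t (j + 1) - t j := fun j => by rw [CharTwo.sub_eq_add, add_comm]
  rw [Finset.sum_congr rfl fun j _ => this j, Finset.sum_range_sub, CharTwo.sub_eq_add, add_comm]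

/-- There is no pair of complementary functions separating the sides of a rectangle both in the
primal and in the dual lattice. -/
theorem no_separation (W H : ℕ) (c d : ℤ → ℤ → ZMod 2)
    (h1 : ∀ i j, (c i j + c (i + 1) j) * (d i j + d i (j - 1)) = 0)
    (h2 : ∀ i j, (c i j + c i (j + 1)) * (d i j + d (i - 1) j) = 0)
    (cL : ∀ j : ℕ, j ≤ H → c 0 j = 1) (cR : ∀ j : ℕ, j ≤ H → c W j = 0)
    (dT : ∀ i : ℕ, i < W → d i H = 1) (dB : ∀ i : ℕ, i < W → d i (-1) = 0) : False := by
  have key : ∀ a x y : ZMod 2, a * (x + y) = 0 → x * a = y * a := by decide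
  have two : ∀ x : ZMod 2, x + x = 0 := by decide
  have hS : ∑ i ∈ Finset.range W, ∑ j ∈ Finset.range H,
      (d i j * (c i j + c (i + 1) j) + d i j * (c i (j + 1) + c (i + 1) (j + 1)) +
        (d i j * (c i j + c i (j + 1)) + d i j * (c (i + 1) j + c (i + 1) (j + 1)))) = 0 := by
    refine Finset.sum_eq_zero fun i _ => Finset.sum_eq_zero fun j _ => ?_
    generalize c i j = x
    generalize c (i + 1) j = y
    generalize c i (j + 1) = z
    generalize c (i + 1) (j + 1) = w
    generalize d i j = e
    revert x y z w e
    decide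
  simp only [Finset.sum_add_distrib (f := fun j : ℕ => _ + _)] at hS
  rw [Finset.sum_add_distrib] at hS
  have hA : ∀ i ∈ Finset.range W, ∑ j ∈ Finset.range H,
      (d i j * (c i j + c (i + 1) j) + d i j * (c i (j + 1) + c (i + 1) (j + 1))) =
      c i H + c (i + 1 : ℕ) H := by
    intro i hi
    rw [Finset.mem_range] at hi
    have := sum_range_charTwo (fun j => d i (j - 1) * (c i j + c (i + 1) j)) H
    have e0 : d i ((0 : ℕ) - 1) = 0 := by simpa using dB i hi
    have eH : d i (H - 1) * (c i H + c (i + 1) H) = c i H + c (i + 1) H := by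
      rw [← key _ _ _ (h1 i H), dT i hi, one_mul]
    simp only [e0, zero_mul, zero_add, eH] at this
    push_cast
    rw [← this]
    refine Finset.sum_congr rfl fun j _ => ?_
    rw [key _ _ _ (h1 i j)]
    push_cast
    rw [add_sub_cancel_right]
  have hB : ∑ i ∈ Finset.range W, ∑ j ∈ Finset.range H,
      (d i j * (c i j + c i (j + 1)) + d i j * (c (i + 1) j + c (i + 1) (j + 1))) = 0 := by
    rw [Finset.sum_comm]
    refine Finset.sum_eq_zero fun j hj => ?_
    rw [Finset.mem_range] at hj
    have := sum_range_charTwo (fun i => d (i - 1) j * (c i j + c i (j + 1))) W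
    have e0 : c (0 : ℕ) j + c (0 : ℕ) (j + 1) = 0 := by
      have h3 := cL j hj.le
      have h4 := cL (j + 1) hj
      push_cast at h3 h4 ⊢
      rw [h3, h4, two]
    have eW : c W j + c W (j + 1) = 0 := by
      have h3 := cR j hj.le
      have h4 := cR (j + 1) hj
      push_cast at h3 h4 ⊢
      rw [h3, h4, two]
    simp only [e0, eW, mul_zero, add_zero] at this
    rw [← this]
    refine Finset.sum_congr rfl fun i _ => ?_
    rw [key _ _ _ (h2 i j)]
    push_cast
    rw [add_sub_cancel_right]
  rw [Finset.sum_congr rfl hA, hB, add_zero, sum_range_charTwo (fun i => c i H)] at hS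
  have h3 := cL H le_rfl
  have h4 := cR H le_rfl
  push_cast at hS
  rw [h3, h4] at hS
  exact absurd hS (by decide)

theorem exists_far (ω : PercConfig) (N : ℕ) :
    (∃ j ∈ Finset.range (N + 1), ω ∈ Far N (0, (j : ℤ))) ∨
      ∃ i ∈ Finset.range (N + 1), dual ω ∈ Far N ((i : ℤ), (N : ℤ)) := by
  classical
  by_contra hcon
  push Not at hcon
  obtain ⟨hc1, hc2⟩ := hcon
  let C : ℤ × ℤ → Prop := fun v => ∃ j ∈ Finset.range (N + 1), Conn ω Set.univ (0, (j : ℤ)) v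
  let E : ℤ × ℤ → Prop := fun v =>
    ∃ i ∈ Finset.range (N + 1), Conn (dual ω) Set.univ ((i : ℤ), (N : ℤ)) v
  have hC : ∀ u v, Op ω u v → (C u ↔ C v) := fun u v h =>
    ⟨fun ⟨j, hj, hh⟩ => ⟨j, hj, hh.tail h trivial⟩, fun ⟨j, hj, hh⟩ => ⟨j, hj, hh.tail h.symm trivial⟩⟩
  have hE' : ∀ u v, Op (dual ω) u v → (E u ↔ E v) := fun u v h =>
    ⟨fun ⟨j, hj, hh⟩ => ⟨j, hj, hh.tail h trivial⟩, fun ⟨j, hj, hh⟩ => ⟨j, hj, hh.tail h.symm trivial⟩⟩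
  have two : ∀ x : ZMod 2, x + x = 0 := by decide
  refine no_separation (N + 1) N (fun i j => if C (i, j) then 1 else 0)
    (fun i j => if E (i, j) then 1 else 0) ?_ ?_ ?_ ?_ ?_ ?_
  · intro i j
    cases h : ω (hE (i, j)) with
    | true =>
      simp only [hC _ _ (op_right.2 h), two, zero_mul]
    | false =>
      have h' : dual ω (vE (i, j - 1)) = true := by rw [dual_vE]; simp [h]
      have := hE' _ _ (op_up.2 h')
      rw [sub_add_cancel] at this
      simp only [this, two, mul_zero]
  · intro i j
    cases h : ω (vE (i, j)) with
    | true =>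
      simp only [hC _ _ (op_up.2 h), two, zero_mul]
    | false =>
      have h' : dual ω (hE (i - 1, j)) = true := by rw [dual_hE]; simp [h]
      have := hE' _ _ (op_right.2 h')
      rw [sub_add_cancel] at this
      simp only [this, two, mul_zero]
  · intro j hj
    exact if_pos ⟨j, Finset.mem_range.2 (by omega), Conn.refl _ _ _⟩
  · intro j hj
    refine if_neg ?_
    rintro ⟨k, hk, h⟩
    refine hc1 k hk ⟨_, ?_, h⟩
    simp only [box, Set.mem_ofPred_eq, Prod.fst_sub, Prod.snd_sub, not_and_or]
    left
    push_cast
    rw [abs_le]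
    omega
  · intro i hi
    exact if_pos ⟨i, Finset.mem_range.2 (by omega), Conn.refl _ _ _⟩
  · intro j hj
    refine if_neg ?_
    rintro ⟨k, hk, h⟩
    refine hc2 k hk ⟨_, ?_, h⟩
    simp only [box, Set.mem_ofPred_eq, Prod.fst_sub, Prod.snd_sub, not_and_or]
    right
    rw [abs_le]
    omega

theorem one_le_far {μ : Measure PercConfig} [IsProbabilityMeasure μ]
    (hμ : IsBernoulliProduct (1 / 2) μ) (N : ℕ) : 1 ≤ (2 * N + 2) * μ.real (Far N 0) := by
  have hcov : (Set.univ : Set PercConfig) ⊆ (⋃ j ∈ Finset.range (N + 1), Far N (0, (j : ℤ))) ∪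
      ⋃ i ∈ Finset.range (N + 1), {ω | dual ω ∈ Far N ((i : ℤ), (N : ℤ))} := by
    intro ω _
    rcases exists_far ω N with ⟨j, hj, h⟩ | ⟨j, hj, h⟩
    · exact Or.inl (Set.mem_biUnion (x := j) hj h)
    · exact Or.inr (Set.mem_biUnion (x := j) hj h)
  have h1 : (1 : ℝ) = μ.real Set.univ := by simp
  rw [h1]
  refine (measureReal_mono hcov).trans ((measureReal_union_le _ _).trans ?_)
  have h2 := measureReal_biUnion_finset_le (μ := μ) (Finset.range (N + 1)) fun j : ℕ => Far N (0, (j : ℤ))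
  have h3 := measureReal_biUnion_finset_le (μ := μ) (Finset.range (N + 1))
    fun i : ℕ => {ω | dual ω ∈ Far N ((i : ℤ), (N : ℤ))}
  simp only [real_dual hμ (witnessed_far _ _).measurableSet, real_far hμ, Finset.sum_const,
    Finset.card_range, nsmul_eq_mul] at h2 h3
  push_cast at h2 h3
  linarith

end Crossing


theorem Ew_congr {S : Finset LatticeEdge} {p : ℝ} {f g : Finset LatticeEdge → ℝ}
    (h : ∀ T ⊆ S, f T = g T) : Ew S p f = Ew S p g :=
  Finset.sum_congr rfl fun T hT => by rw [h T (Finset.mem_powerset.1 hT)]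

theorem Ew_linear {S : Finset LatticeEdge} {p a b : ℝ} {f g : Finset LatticeEdge → ℝ} :
    Ew S p (fun T => a * f T + b * g T) = a * Ew S p f + b * Ew S p g := by
  simp only [Ew, Finset.mul_sum, ← Finset.sum_add_distrib]
  exact Finset.sum_congr rfl fun T _ => by ring

theorem Ew_insert' {S : Finset LatticeEdge} {a : LatticeEdge} (ha : a ∉ S) (p : ℝ)
    (f : Finset LatticeEdge → ℝ) :
    Ew (insert a S) p f = (1 - p) * Ew S p f + p * Ew S p (fun T => f (insert a T)) := by
  rw [Ew_insert ha, Ew_linear]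

theorem Ew_mono_param {p q : ℝ} (hp : p ∈ Set.Ioo (0 : ℝ) 1) (hq : q ∈ Set.Ioo (0 : ℝ) 1)
    (hpq : p ≤ q) (S : Finset LatticeEdge) (f : Finset LatticeEdge → ℝ) (hf : Monotone f) :
    Ew S p f ≤ Ew S q f := by
  induction S using Finset.induction_on generalizing f with
  | empty => simp [Ew]
  | insert a S ha ih =>
    rw [Ew_insert' ha, Ew_insert' ha]
    have h1 := ih f hf
    have h2 := ih (fun T => f (insert a T)) fun T T' h => hf (Finset.insert_subset_insert a h)
    have h3 : Ew S q f ≤ Ew S q (fun T => f (insert a T)) :=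
      Ew_mono hq fun T => hf (Finset.subset_insert a T)
    have h4 := mul_le_mul_of_nonneg_left h1 (by linarith [hp.2] : 0 ≤ 1 - p)
    have h5 := mul_le_mul_of_nonneg_left h2 hp.1.le
    have h6 := mul_le_mul_of_nonneg_left h3 (sub_nonneg.2 hpq)
    linarith

/-- Russo's formula. -/
theorem hasDerivAt_Ew (S : Finset LatticeEdge) (f : Finset LatticeEdge → ℝ) (p : ℝ) :
    HasDerivAt (fun p => Ew S p f)
      (∑ e ∈ S, Ew S p (fun T => f (insert e T) - f (T.erase e))) p := by
  induction S using Finset.induction_on generalizing f with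
  | empty => simpa [Ew] using hasDerivAt_const p (f ∅)
  | insert a S ha ih =>
    simp only [Ew_insert' ha]
    have h1 := ((hasDerivAt_id p).const_sub 1).mul (ih f)
    have h2 := (hasDerivAt_id p).mul (ih fun T => f (insert a T))
    refine (h1.add h2).congr_deriv ?_
    rw [Finset.sum_insert ha, Finset.sum_add_distrib, ← Finset.mul_sum, ← Finset.mul_sum]
    have e1 : Ew S p (fun T => f (insert a T) - f (T.erase a)) =
        Ew S p (fun T => f (insert a T)) - Ew S p f := by
      have := Ew_linear (S := S) (p := p) (a := 1) (b := -1) (f := fun T => f (insert a T)) (g := f)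
      rw [one_mul, neg_one_mul, ← sub_eq_add_neg] at this
      rw [← this]
      refine Ew_congr fun T hT => ?_
      rw [Finset.erase_eq_of_notMem fun h => ha (hT h)]
      ring
    have e2 : Ew S p (fun T => f (insert a (insert a T)) - f ((insert a T).erase a)) =
        Ew S p (fun T => f (insert a T) - f (T.erase a)) := by
      refine Ew_congr fun T hT => ?_
      have : a ∉ T := fun h => ha (hT h)
      rw [Finset.insert_idem, Finset.erase_insert this, Finset.erase_eq_of_notMem this]
    have e3 : ∑ e ∈ S, Ew S p (fun T => f (insert e (insert a T)) - f ((insert a T).erase e)) =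
        ∑ e ∈ S, Ew S p (fun T => f (insert a (insert e T)) - f (insert a (T.erase e))) := by
      refine Finset.sum_congr rfl fun e he => ?_
      have hne : a ≠ e := fun h => ha (h ▸ he)
      refine Ew_congr fun T _ => ?_
      rw [Finset.insert_comm, Finset.erase_insert_of_ne hne]
    rw [e2, e1, e3]
    simp only [id]
    ring

theorem Ew_closed {S : Finset LatticeEdge} {e : LatticeEdge} (he : e ∈ S) (p : ℝ)
    (f : Finset LatticeEdge → ℝ) :
    Ew S p (fun T => if e ∈ T then 0 else f (insert e T) - f T) =
      (1 - p) * Ew S p (fun T => f (insert e T) - f (T.erase e)) := by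
  obtain ⟨S, hS, rfl⟩ : ∃ S', e ∉ S' ∧ insert e S' = S :=
    ⟨S.erase e, Finset.notMem_erase _ _, Finset.insert_erase he⟩
  rw [Ew_insert' hS, Ew_insert' hS]
  have e0 : Ew S p (fun T => if e ∈ insert e T then 0 else f (insert e (insert e T)) - f (insert e T)) =
      0 := by
    simp [Ew]
  have e1 : Ew S p (fun T => if e ∈ T then 0 else f (insert e T) - f T) =
      Ew S p (fun T => f (insert e T) - f (T.erase e)) := by
    refine Ew_congr fun T hT => ?_
    have : e ∉ T := fun h => hS (hT h)
    rw [if_neg this, Finset.erase_eq_of_notMem this]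
  have e2 : Ew S p (fun T => f (insert e (insert e T)) - f ((insert e T).erase e)) =
      Ew S p (fun T => f (insert e T) - f (T.erase e)) := by
    refine Ew_congr fun T hT => ?_
    have : e ∉ T := fun h => hS (hT h)
    rw [Finset.insert_idem, Finset.erase_insert this, Finset.erase_eq_of_notMem this]
  rw [e0, e1, e2]
  ring

theorem touch_finite {S : Set (ℤ × ℤ)} (hS : S.Finite) : {e : LatticeEdge | e.1 ∈ touch S}.Finite := by
  refine (hS.biUnion fun v _ => Set.toFinite {hE v, hE (v.1 - 1, v.2), vE v, vE (v.1, v.2 - 1)}).subset ?_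
  intro e he
  obtain ⟨⟨⟨a, b⟩, c⟩, rfl⟩ := toEdge_bijective.2 e
  cases c with
  | false =>
    rcases mem_touch.1 he with h | h
    · exact Set.mem_biUnion h (Or.inl rfl)
    · exact Set.mem_biUnion h (Or.inr (Or.inl (by simp [toEdge])))
  | true =>
    rcases mem_touch.1 he with h | h
    · exact Set.mem_biUnion h (Or.inr (Or.inr (Or.inl rfl)))
    · exact Set.mem_biUnion h (Or.inr (Or.inr (Or.inr (by simp [toEdge]))))

/-- The lattice edges touching a finite set of vertices. -/
noncomputable def touchF (S : Finset (ℤ × ℤ)) : Finset LatticeEdge :=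
  (touch_finite S.finite_toSet).toFinset

theorem mem_touchF {S : Finset (ℤ × ℤ)} {e : LatticeEdge} : e ∈ touchF S ↔ e.1 ∈ touch (S : Set
    (ℤ × ℤ)) := by
  simp [touchF]

theorem touchF_mono {S T : Finset (ℤ × ℤ)} (h : S ⊆ T) : touchF S ⊆ touchF T := fun _ he =>
  mem_touchF.2 (touch_mono (Finset.coe_subset.2 h) (mem_touchF.1 he))

theorem DepOn.touchF {F : Set PercConfig} {S : Finset (ℤ × ℤ)} (h : DepOn F (touch (S : Set (ℤ × ℤ)))) :
    DepOn F (Subtype.val '' (Kesten.touchF S : Set LatticeEdge)) := by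
  intro ω ω' hw
  exact h ω ω' fun e he => hw e ⟨e, mem_touchF.2 he, rfl⟩

/-- The box as a finset. -/
noncomputable def boxF (N : ℕ) : Finset (ℤ × ℤ) := (box_finite N).toFinset

theorem coe_boxF (N : ℕ) : (boxF N : Set (ℤ × ℤ)) = box N := by simp [boxF]

theorem depOn_far (N : ℕ) : DepOn (Far N 0) (Subtype.val '' (touchF (boxF N) : Set LatticeEdge)) := by
  apply DepOn.touchF
  rw [coe_boxF, far_zero]
  exact depOn_arm _ _ _

theorem real_far_mono {p q : ℝ} (hp : p ∈ Set.Ioo (0 : ℝ) 1) (hq : q ∈ Set.Ioo (0 : ℝ) 1)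
    (hpq : p ≤ q) {μ ν : Measure PercConfig} [IsProbabilityMeasure μ] [IsProbabilityMeasure ν]
    (hμ : IsBernoulliProduct p μ) (hν : IsBernoulliProduct q ν) (N : ℕ) :
    μ.real (Far N 0) ≤ ν.real (Far N 0) := by
  rw [real_eq_Ew hp hμ (depOn_far N), real_eq_Ew hq hν (depOn_far N)]
  exact Ew_mono_param hp hq hpq _ _ (ind_mono fun _ _ h => (witnessed_far N 0).mono h)

/-- The edge `e` leaves `S` from a vertex joined to the origin inside `S`. -/
def Bd (S : Finset (ℤ × ℤ)) (e : LatticeEdge) : Set PercConfig :=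
  {ω | ∃ x ∈ S, ∃ y ∉ S, e.1 = s(x, y) ∧ Conn ω (inside (S : Set (ℤ × ℤ))) 0 x}

theorem witnessed_Bd (S : Finset (ℤ × ℤ)) (e : LatticeEdge) : Witnessed (Bd S e) := by
  have : Bd S e = ⋃ x, ⋃ (_ : x ∈ S), ⋃ y, ⋃ (_ : y ∉ S), ⋃ (_ : e.1 = s(x, y)),
      {ω | Conn ω (inside (S : Set (ℤ × ℤ))) 0 x} := by
    ext ω; simp only [Bd, Set.mem_ofPred_eq, Set.mem_iUnion, exists_prop]
  rw [this]
  exact Witnessed.iUnion fun x => Witnessed.iUnion fun _ => Witnessed.iUnion fun y =>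
    Witnessed.iUnion fun _ => Witnessed.iUnion fun _ => witnessed_conn _ _ _

theorem depOn_Bd (S : Finset (ℤ × ℤ)) (e : LatticeEdge) :
    DepOn (Bd S e) (inside (S : Set (ℤ × ℤ))) := by
  rintro ω ω' h ⟨x, hx, y, hy, he, hc⟩
  exact ⟨x, hx, y, hy, he, hc.congr h⟩

/-- The expected number of exit edges. -/
noncomputable def phi (μ : Measure PercConfig) (S : Finset (ℤ × ℤ)) : ℝ :=
  ∑ e ∈ touchF S, μ.real (Bd S e)

/-- The origin's cluster inside `S` is `C`. -/
def ClusterIs (S C : Finset (ℤ × ℤ)) : Set PercConfig :=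
  {ω | ∀ v, v ∈ C ↔ Conn ω (inside (S : Set (ℤ × ℤ))) 0 v}

theorem measurableSet_clusterIs (S C : Finset (ℤ × ℤ)) : MeasurableSet (ClusterIs S C) := by
  have : ClusterIs S C = ⋂ v, {ω | v ∈ C ↔ Conn ω (inside (S : Set (ℤ × ℤ))) 0 v} := by
    ext ω; simp [ClusterIs]
  rw [this]
  refine MeasurableSet.iInter fun v => ?_
  have hm := (witnessed_conn (inside (S : Set (ℤ × ℤ))) 0 v).measurableSet
  by_cases hv : v ∈ C
  · simpa [hv] using hm
  · simp only [hv, false_iff]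
    exact hm.compl

theorem depOn_clusterIs (S C : Finset (ℤ × ℤ)) :
    DepOn (ClusterIs S C) (inside (S : Set (ℤ × ℤ)) ∩ touch (C : Set (ℤ × ℤ))) := by
  intro ω ω' h hC v
  have key : ∀ v, Conn ω (inside (S : Set (ℤ × ℤ))) 0 v →
      Conn ω (inside (S : Set (ℤ × ℤ)) ∩ touch (C : Set (ℤ × ℤ))) 0 v := by
    intro v hv
    induction hv with
    | refl => exact Conn.refl _ _ _
    | tail h1 h2 ih => exact ih.tail h2.1 ⟨h2.2, mem_touch.2 (Or.inl ((hC _).2 h1))⟩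
  constructor
  · intro hv
    exact ((key v ((hC v).1 hv)).congr h).mono_set Set.inter_subset_left
  · intro hv
    by_contra hvC
    have h0 : (0 : ℤ × ℤ) ∈ (C : Set (ℤ × ℤ)) := (hC 0).2 (Conn.refl _ _ _)
    obtain ⟨x, hx, y, hy, -, ho, hs, -⟩ := hv.exit h0 (by simpa using hvC)
    have ho' : Op ω x y := ⟨ho.1, (h _ ⟨hs, mem_touch.2 (Or.inl hx)⟩).trans ho.2⟩
    exact hy ((hC y).2 (((hC x).1 hx).tail ho' hs))

theorem Conn.mem_of_inside {ω : PercConfig} {S : Set (ℤ × ℤ)} {u v : ℤ × ℤ}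
    (h : Conn ω (inside S) u v) (hu : u ∈ S) : v ∈ S := by
  induction h with
  | refl => exact hu
  | tail _ h2 _ => exact (mem_inside.1 h2.2).2

theorem exists_clusterIs (S : Finset (ℤ × ℤ)) (h0 : 0 ∈ S) (ω : PercConfig) :
    ∃ C ∈ S.powerset, ω ∈ ClusterIs S C := by
  classical
  refine ⟨S.filter fun v => Conn ω (inside (S : Set (ℤ × ℤ))) 0 v,
    Finset.mem_powerset.2 (Finset.filter_subset _ _), fun v => ?_⟩
  rw [Finset.mem_filter]
  exact ⟨fun h => h.2, fun h => ⟨h.mem_of_inside h0, h⟩⟩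

theorem pairwiseDisjoint_clusterIs (S : Finset (ℤ × ℤ)) (s : Set (Finset (ℤ × ℤ))) :
    s.PairwiseDisjoint (ClusterIs S) := by
  intro C _ C' _ hne
  refine Set.disjoint_left.2 fun ω h h' => hne ?_
  ext v
  rw [h v, h' v]

theorem compl_touch (C : Set (ℤ × ℤ)) : (touch C)ᶜ = inside Cᶜ := by
  ext e
  induction e using Sym2.ind with
  | _ u v => simp [mem_touch, mem_inside]

section Decay

theorem real_open {p : ℝ} {μ : Measure PercConfig} (hp : p ∈ Set.Ioo (0 : ℝ) 1)
    (hμ : IsBernoulliProduct p μ) (e : LatticeEdge) :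
    μ.real {ω | ω e = true} = p := by
  have := real_cyl hp hμ {e} fun _ => true
  simpa [cyl] using this

variable {p : ℝ} {μ : Measure PercConfig} [IsProbabilityMeasure μ]

theorem far_subset {S : Finset (ℤ × ℤ)} {L : ℕ} (h0 : 0 ∈ S) (hL : (S : Set (ℤ × ℤ)) ⊆ box L) (N : ℕ)
    {ω : PercConfig} (hω : ω ∈ Far (N + L + 1) 0) :
    ∃ C ∈ S.powerset, ω ∈ ClusterIs S C ∧ ∃ x ∈ C, ∃ y ∉ S, Op ω x y ∧
      ∃ z, z - y ∉ box N ∧ Conn ω (inside (C : Set (ℤ × ℤ))ᶜ) y z := by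
  obtain ⟨C, hCS, hC⟩ := exists_clusterIs S h0 ω
  obtain ⟨z, hz, hc⟩ := hω
  rw [sub_zero] at hz
  have h0C : (0 : ℤ × ℤ) ∈ C := (hC 0).2 (Conn.refl _ _ _)
  have hCS' := Finset.mem_powerset.1 hCS
  have hzC : z ∈ (C : Set (ℤ × ℤ))ᶜ := by
    intro h
    have := hL (hCS' h)
    refine hz ⟨this.1.trans ?_, this.2.trans ?_⟩ <;> push_cast <;> omega
  obtain ⟨y, hy, x, hx, h1, h2, -, -⟩ := hc.symm.exit hzC (fun h => h h0C)
  have hx' : x ∈ C := by simpa using hx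
  have hyS : y ∉ S := by
    intro h
    exact hy ((hC y).2 (((hC x).1 hx').tail h2.symm (mem_inside.2 ⟨hCS' hx', h⟩)))
  refine ⟨C, hCS, hC, x, hx', y, hyS, h2.symm, z, fun hb => hz ?_,
      (h1.mono_set Set.inter_subset_right).symm⟩
  have hxL := hL (hCS' hx')
  obtain ⟨hb1, hb2⟩ := hb
  obtain ⟨hx1, hx2⟩ := hxL
  simp only [Prod.fst_sub, Prod.snd_sub, abs_le] at hb1 hb2 hx1 hx2
  rcases h2.cases with h | h | h | h <;>
    · have := congrArg Prod.fst h
      have := congrArg Prod.snd h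
      constructor <;> rw [abs_le] <;> push_cast <;> simp only at * <;> omega

theorem far_step (hp : p ∈ Set.Ioo (0 : ℝ) 1) (hμ : IsBernoulliProduct p μ)
    {S : Finset (ℤ × ℤ)} {L : ℕ} (h0 : 0 ∈ S) (hL : (S : Set (ℤ × ℤ)) ⊆ box L) (N : ℕ) :
    μ.real (Far (N + L + 1) 0) ≤ p * phi μ S * μ.real (Far N 0) := by
  classical
  let G : LatticeEdge → Finset (ℤ × ℤ) → Set PercConfig := fun e C =>
    {ω | ω ∈ ClusterIs S C ∧ ∃ x ∈ C, ∃ y ∉ S, e.1 = s(x, y) ∧ ω e = true ∧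
      ∃ z, z - y ∉ box N ∧ Conn ω (inside (C : Set (ℤ × ℤ))ᶜ) y z}
  have hcov : Far (N + L + 1) 0 ⊆ ⋃ e ∈ touchF S, ⋃ C ∈ S.powerset, G e C := by
    intro ω hω
    obtain ⟨C, hCS, hC, x, hx, y, hy, ho, hz⟩ := far_subset h0 hL N hω
    simp only [Set.mem_iUnion, exists_prop]
    exact ⟨⟨s(x, y), ho.1⟩, mem_touchF.2 (mem_touch.2 (Or.inl (Finset.mem_powerset.1 hCS hx))),
      C, hCS, hC, x, hx, y, hy, rfl, ho.2, hz⟩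
  have hG : ∀ e, ∀ C ∈ S.powerset,
      μ.real (G e C) ≤ p * μ.real (Far N 0) * μ.real (ClusterIs S C ∩ Bd S e) := by
    intro e C hCS
    rw [Finset.mem_powerset] at hCS
    by_cases hxy : ∃ x ∈ C, ∃ y ∉ S, e.1 = s(x, y)
    · obtain ⟨x, hx, y, hy, he⟩ := hxy
      let I : Set PercConfig := {ω | ∃ z, z - y ∉ box N ∧ Conn ω (inside (C : Set (ℤ × ℤ))ᶜ) y z}
      have hI : Witnessed I := by
        have : I = ⋃ z, ⋃ (_ : z - y ∉ box N), {ω | Conn ω (inside (C : Set (ℤ × ℤ))ᶜ) y z} := by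
          ext ω; simp [I]
        rw [this]
        exact Witnessed.iUnion fun x => Witnessed.iUnion fun _ => witnessed_conn _ _ _
      have hGs : G e C ⊆ (ClusterIs S C ∩ {ω | ω e = true}) ∩ I := by
        rintro ω ⟨h1, x', hx', y', hy', he', ho, hz⟩
        have : y' = y := by
          rcases Sym2.eq_iff.1 (he.symm.trans he') with ⟨_, h⟩ | ⟨h, _⟩
          · exact h.symm
          · exact absurd (hCS hx) (h ▸ hy')
        subst this
        exact ⟨⟨h1, ho⟩, hz⟩
      have m1 := measurableSet_clusterIs S C
      have m2 : MeasurableSet {ω : PercConfig | ω e = true} :=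
        measurable_eval e (measurableSet_singleton true)
      have d2 : ∀ D : Set (Sym2 (ℤ × ℤ)), e.1 ∈ D → DepOn {ω : PercConfig | ω e = true} D :=
        fun D hD ω ω' h hw => (h e hD).symm.trans hw
      have i1 : μ.real (ClusterIs S C ∩ {ω | ω e = true}) = μ.real (ClusterIs S C) * p := by
        rw [indep_of_depOn hμ ((depOn_clusterIs S C).mono Set.inter_subset_left) (d2 _ ?_) m1 m2,
          real_open hp hμ]
        rw [he]
        exact fun h => hy (mem_inside.1 h).2
      have i2 : μ.real ((ClusterIs S C ∩ {ω | ω e = true}) ∩ I) =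
          μ.real (ClusterIs S C ∩ {ω | ω e = true}) * μ.real I := by
        refine indep_of_depOn hμ (D := touch (C : Set (ℤ × ℤ))) (DepOn.inter ((depOn_clusterIs S C).mono
          Set.inter_subset_right) (d2 _ ?_)) ?_ (m1.inter m2) hI.measurableSet
        · rw [he]
          exact mem_touch.2 (Or.inl hx)
        · rw [compl_touch]
          rintro ω ω' h ⟨z, hz, hc⟩
          exact ⟨z, hz, hc.congr h⟩
      have i3 : μ.real I ≤ μ.real (Far N 0) := by
        rw [← real_far hμ N y]
        refine measureReal_mono ?_
        rintro ω ⟨z, hz, hc⟩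
        exact ⟨z, hz, hc.mono_set (Set.subset_univ _)⟩
      have i4 : ClusterIs S C ∩ Bd S e = ClusterIs S C := by
        refine Set.inter_eq_left.2 fun ω hω => ⟨x, hCS hx, y, hy, he, (hω x).1 hx⟩
      rw [i4]
      calc μ.real (G e C) ≤ μ.real (ClusterIs S C) * p * μ.real I := by
            rw [← i1, ← i2]
            exact measureReal_mono hGs
        _ ≤ μ.real (ClusterIs S C) * p * μ.real (Far N 0) :=
            mul_le_mul_of_nonneg_left i3 (mul_nonneg measureReal_nonneg hp.1.le)
        _ = _ := by ring
    · have : G e C = ∅ := by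
        ext ω
        simp only [Set.mem_empty_iff_false, iff_false]
        rintro ⟨_, x, hx, y, hy, he, _⟩
        exact hxy ⟨x, hx, y, hy, he⟩
      rw [this, measureReal_empty]
      exact mul_nonneg (mul_nonneg hp.1.le measureReal_nonneg) measureReal_nonneg
  have hsum : ∀ e, ∑ C ∈ S.powerset, μ.real (ClusterIs S C ∩ Bd S e) ≤ μ.real (Bd S e) := by
    intro e
    rw [← measureReal_biUnion_finset]
    · exact measureReal_mono (Set.iUnion₂_subset fun C _ => Set.inter_subset_right)
    · exact (pairwiseDisjoint_clusterIs S _).mono_on fun C _ => Set.inter_subset_left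
    · exact fun C _ => (measurableSet_clusterIs S C).inter (witnessed_Bd S e).measurableSet
  calc μ.real (Far (N + L + 1) 0) ≤ μ.real (⋃ e ∈ touchF S, ⋃ C ∈ S.powerset, G e C) :=
        measureReal_mono hcov (measure_ne_top _ _)
    _ ≤ ∑ e ∈ touchF S, μ.real (⋃ C ∈ S.powerset, G e C) := measureReal_biUnion_finset_le _ _
    _ ≤ ∑ e ∈ touchF S, ∑ C ∈ S.powerset, μ.real (G e C) :=
        Finset.sum_le_sum fun e _ => measureReal_biUnion_finset_le _ _
    _ ≤ ∑ e ∈ touchF S, p * μ.real (Far N 0) * μ.real (Bd S e) := by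
        refine Finset.sum_le_sum fun e _ => (Finset.sum_le_sum (hG e)).trans ?_
        rw [← Finset.mul_sum]
        exact mul_le_mul_of_nonneg_left (hsum e) (mul_nonneg hp.1.le measureReal_nonneg)
    _ = _ := by
        rw [← Finset.mul_sum, phi]
        ring

theorem one_le_phi {p : ℝ} (hp : p ∈ Set.Ioo (0 : ℝ) 1) {μ : Measure PercConfig}
    [IsProbabilityMeasure μ] (hμ : IsBernoulliProduct p μ)
    (hfar : ∀ N : ℕ, 1 ≤ (2 * N + 2) * μ.real (Far N 0))
    {S : Finset (ℤ × ℤ)} (h0 : 0 ∈ S) : 1 ≤ p * phi μ S := by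
  by_contra hlt
  push Not at hlt
  obtain ⟨L, hL⟩ := exists_box S.finite_toSet
  set c := p * phi μ S with hc
  have hc0 : 0 ≤ c := mul_nonneg hp.1.le (Finset.sum_nonneg fun _ _ => measureReal_nonneg)
  have hdec : ∀ k : ℕ, μ.real (Far (k * (L + 1)) 0) ≤ c ^ k := by
    intro k
    induction k with
    | zero => simp
    | succ k ih =>
      have h1 := far_step hp hμ h0 hL (k * (L + 1))
      rw [← hc] at h1
      have h2 := mul_le_mul_of_nonneg_left ih hc0
      rw [show (k + 1) * (L + 1) = k * (L + 1) + L + 1 by ring, pow_succ']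
      exact h1.trans h2
  have hlim : Filter.Tendsto (fun k : ℕ => 2 * (L + 1) * (k * c ^ k) + 2 * c ^ k) Filter.atTop
      (nhds (2 * (L + 1) * 0 + 2 * 0)) :=
    ((tendsto_self_mul_const_pow_of_lt_one hc0 hlt).const_mul _).add
      ((tendsto_pow_atTop_nhds_zero_of_lt_one hc0 hlt).const_mul _)
  have hge : ∀ k : ℕ, 1 ≤ 2 * ((L : ℝ) + 1) * (k * c ^ k) + 2 * c ^ k := by
    intro k
    have h1 := hfar (k * (L + 1))
    push_cast at h1
    have h2 := mul_le_mul_of_nonneg_left (hdec k)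
      (by positivity : (0 : ℝ) ≤ 2 * (k * (L + 1)) + 2)
    linarith
  have := ge_of_tendsto' hlim hge
  norm_num at this

end Decay


/-- The set of vertices not joined to the complement of the box is `S`. -/
def Sep (N : ℕ) (S : Finset (ℤ × ℤ)) : Set PercConfig :=
  {ω | ∀ v, v ∈ S ↔ ¬ ∃ y ∉ box N, Conn ω Set.univ v y}

theorem measurableSet_sep (N : ℕ) (S : Finset (ℤ × ℤ)) : MeasurableSet (Sep N S) := by
  have hW : ∀ v, Witnessed {ω | ∃ y ∉ box N, Conn ω Set.univ v y} := by
    intro v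
    have : {ω | ∃ y ∉ box N, Conn ω Set.univ v y} =
        ⋃ y, ⋃ (_ : y ∉ box N), {ω | Conn ω Set.univ v y} := by
      ext ω; simp only [Set.mem_ofPred_eq, Set.mem_iUnion, exists_prop]
    rw [this]
    exact Witnessed.iUnion fun y => Witnessed.iUnion fun _ => witnessed_conn _ _ _
  have : Sep N S = ⋂ v, {ω | v ∈ S ↔ ¬ ∃ y ∉ box N, Conn ω Set.univ v y} := by
    ext ω; simp only [Sep, Set.mem_ofPred_eq, Set.mem_iInter]
  rw [this]
  refine MeasurableSet.iInter fun v => ?_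
  have hm := (hW v).measurableSet
  by_cases hv : v ∈ S
  · simp only [hv, true_iff]
    exact hm.compl
  · simp only [hv, false_iff, not_not]
    exact hm

theorem sep_subset_box {N : ℕ} {S : Finset (ℤ × ℤ)} {ω : PercConfig} (h : ω ∈ Sep N S) :
    S ⊆ boxF N := by
  intro v hv
  by_contra hb
  exact (h v).1 hv ⟨v, by simpa [boxF] using hb, Conn.refl _ _ _⟩

theorem depOn_sep (N : ℕ) (S : Finset (ℤ × ℤ)) : DepOn (Sep N S) (inside (S : Set (ℤ × ℤ)))ᶜ := by
  intro ω ω' h hS v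
  constructor
  · rintro hv ⟨y, hy, hc⟩
    have hyS : y ∉ S := fun h => (hS y).1 h ⟨y, hy, Conn.refl _ _ _⟩
    obtain ⟨a, ha, b, hb, -, ho, -, -⟩ := hc.exit (U := (S : Set (ℤ × ℤ))) hv (by simpa using hyS)
    have ho' : Op ω a b := ⟨ho.1, (h _ fun hi => hb (mem_inside.1 hi).2).trans ho.2⟩
    have hb' : ∃ y ∉ box N, Conn ω Set.univ b y := by
      by_contra hcon
      exact hb ((hS b).2 hcon)
    obtain ⟨z, hz, hbz⟩ := hb'
    exact (hS a).1 ha ⟨z, hz, (Conn.single (D := Set.univ) ho' (Set.mem_univ _)).trans hbz⟩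
  · intro hv
    by_contra hvS
    have : ∃ y ∉ box N, Conn ω Set.univ v y := by
      by_contra hcon
      exact hvS ((hS v).2 hcon)
    obtain ⟨y, hy, hc⟩ := this
    refine hv ⟨y, hy, ?_⟩
    have key : Conn ω (inside (S : Set (ℤ × ℤ)))ᶜ v y := by
      clear hv hvS
      induction hc using Relation.ReflTransGen.head_induction_on with
      | refl => exact Conn.refl _ _ _
      | @head a c h1 h2 ih =>
        refine Relation.ReflTransGen.head ⟨h1.1, fun hi => ?_⟩ ih
        exact (hS a).1 (mem_inside.1 hi).1 ⟨y, hy, Relation.ReflTransGen.head h1 h2⟩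
    exact (key.congr h).mono_set (Set.subset_univ _)

/-- The edge `e` is closed and opening it joins the origin to the complement of the box. -/
def Piv (N : ℕ) (e : LatticeEdge) : Set PercConfig :=
  {ω | ω e = false ∧ ω ∉ Far N 0 ∧ Function.update ω e true ∈ Far N 0}

theorem mem_far_zero {N : ℕ} {ω : PercConfig} : ω ∈ Far N 0 ↔ ∃ y ∉ box N, Conn ω Set.univ 0 y := by
  simp only [Far, sub_zero, Set.mem_ofPred_eq]

theorem le_update (ω : PercConfig) (e : LatticeEdge) :
    ∀ e', ω e' = true → Function.update ω e true e' = true := by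
  intro e' h
  by_cases hee : e' = e
  · subst hee; simp
  · rw [Function.update_of_ne hee, h]

theorem sep_inter_Bd {N : ℕ} {S : Finset (ℤ × ℤ)} (h0 : 0 ∈ S) (e : LatticeEdge) :
    Sep N S ∩ Bd S e ⊆ Piv N e := by
  rintro ω ⟨hS, x, hx, y, hy, he, hc⟩
  have hy' : ∃ z ∉ box N, Conn ω Set.univ y z := by
    by_contra hcon
    exact hy ((hS y).2 hcon)
  obtain ⟨z, hz, hyz⟩ := hy'
  obtain ⟨e, hel⟩ := e
  subst he
  refine ⟨?_, fun h => (hS 0).1 h0 (mem_far_zero.1 h), mem_far_zero.2 ⟨z, hz, ?_⟩⟩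
  · by_contra hop
    rw [Bool.not_eq_false] at hop
    exact (hS x).1 hx ⟨z, hz, (Conn.single (D := Set.univ) ⟨hel, hop⟩ (Set.mem_univ _)).trans hyz⟩
  · have h1 := (hc.mono_set (Set.subset_univ _)).mono (le_update ω ⟨s(x, y), hel⟩)
    have h2 := hyz.mono (le_update ω ⟨s(x, y), hel⟩)
    exact (h1.tail ⟨hel, Function.update_self
        (β := fun _ : LatticeEdge => Bool) ⟨s(x, y), hel⟩ true ω⟩ (Set.mem_univ _)).trans h2

theorem depOn_piv (N : ℕ) {e : LatticeEdge} (he : e ∈ touchF (boxF N)) :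
    DepOn (Piv N e) (Subtype.val '' (touchF (boxF N) : Set LatticeEdge)) := by
  rintro ω ω' h ⟨h1, h2, h3⟩
  refine ⟨(h e ⟨e, he, rfl⟩).symm.trans h1, (depOn_far N).compl ω ω' h h2, ?_⟩
  refine depOn_far N _ _ (fun e' he' => ?_) h3
  by_cases hee : e' = e
  · subst hee; simp
  · rw [Function.update_of_ne hee, Function.update_of_ne hee, h e' he']

theorem ind_piv (N : ℕ) (e : LatticeEdge) (T : Finset LatticeEdge) :
    ind (Piv N e) T = if e ∈ T then 0 else ind (Far N 0) (insert e T) - ind (Far N 0) T := by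
  have hu : Function.update (conf T) e true = conf (insert e T) := by
    ext e'
    by_cases hee : e' = e
    · subst hee; simp [conf]
    · simp [conf, hee]
  have hm : conf T ∈ Far N 0 → conf (insert e T) ∈ Far N 0 := by
    rw [← hu]
    exact (witnessed_far N 0).mono (le_update _ _)
  have hmem : conf T ∈ Piv N e ↔
      conf T e = false ∧ conf T ∉ Far N 0 ∧ conf (insert e T) ∈ Far N 0 := by
    rw [← hu]
    exact Iff.rfl
  have h0 : ∀ (F : Set PercConfig) (T : Finset LatticeEdge), conf T ∉ F → ind F T = 0 :=
    fun _ _ h => if_neg h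
  have h1 : ∀ (F : Set PercConfig) (T : Finset LatticeEdge), conf T ∈ F → ind F T = 1 :=
    fun _ _ h => if_pos h
  by_cases he : e ∈ T
  · rw [if_pos he, h0 _ _ fun h => ?_]
    have hce : conf T e = true := by simp [conf, he]
    exact absurd ((hmem.1 h).1) (by rw [hce]; decide)
  have hce : conf T e = false := by simp [conf, he]
  rw [if_neg he]
  by_cases hT : conf T ∈ Far N 0
  · rw [h0 _ _ fun h => (hmem.1 h).2.1 hT, h1 _ _ hT, h1 _ _ (hm hT), sub_self]
  · by_cases hT' : conf (insert e T) ∈ Far N 0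
    · rw [h1 _ _ (hmem.2 ⟨hce, hT, hT'⟩), h0 _ _ hT, h1 _ _ hT', sub_zero]
    · rw [h0 _ _ fun h => hT' (hmem.1 h).2.2, h0 _ _ hT, h0 _ _ hT', sub_zero]

section Russo

variable {p : ℝ} {μ : Measure PercConfig} [IsProbabilityMeasure μ]

theorem deriv_eq_piv (hp : p ∈ Set.Ioo (0 : ℝ) 1) (hμ : IsBernoulliProduct p μ) (N : ℕ) :
    HasDerivAt (fun q => Ew (touchF (boxF N)) q (ind (Far N 0)))
      ((1 - p)⁻¹ * ∑ e ∈ touchF (boxF N), μ.real (Piv N e)) p := by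
  refine (hasDerivAt_Ew _ _ p).congr_deriv ?_
  rw [Finset.mul_sum]
  refine Finset.sum_congr rfl fun e he => ?_
  have h1 : 1 - p ≠ 0 := by linarith [hp.2]
  rw [real_eq_Ew hp hμ (depOn_piv N he), eq_inv_mul_iff_mul_eq₀ h1, ← Ew_closed he]
  exact Ew_congr fun T _ => (ind_piv N e T).symm

theorem le_sum_piv (hp : p ∈ Set.Ioo (0 : ℝ) 1) (hμ : IsBernoulliProduct p μ) (N : ℕ)
    (hphi : ∀ S : Finset (ℤ × ℤ), 0 ∈ S → 1 ≤ p * phi μ S) :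
    1 - μ.real (Far N 0) ≤ p * ∑ e ∈ touchF (boxF N), μ.real (Piv N e) := by
  classical
  set Q := (boxF N).powerset.filter fun S => 0 ∈ S with hQ
  have hdisj : (Q : Set (Finset (ℤ × ℤ))).PairwiseDisjoint (Sep N) := by
    intro S _ S' _ hne
    refine Set.disjoint_left.2 fun ω h h' => hne ?_
    ext v
    rw [h v, h' v]
  have h1 : (Far N 0)ᶜ ⊆ ⋃ S ∈ Q, Sep N S := by
    intro ω hω
    have hfin : {v | ¬ ∃ y ∉ box N, Conn ω Set.univ v y}.Finite := by
      refine (box_finite N).subset fun v hv => ?_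
      by_contra hb
      exact hv ⟨v, hb, Conn.refl _ _ _⟩
    have hS : ω ∈ Sep N hfin.toFinset := fun v => by
      rw [Set.Finite.mem_toFinset, Set.mem_ofPred_eq]
    refine Set.mem_biUnion (x := hfin.toFinset) ?_ hS
    simp only [hQ, Finset.coe_filter, Set.mem_ofPred_eq, Finset.mem_powerset]
    exact ⟨sep_subset_box hS, (hS 0).2 fun h => hω (mem_far_zero.2 h)⟩
  have h2 : ∀ e ∈ touchF (boxF N), ∑ S ∈ Q, μ.real (Sep N S) * μ.real (Bd S e) ≤ μ.real (Piv N e) := by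
    intro e _
    have : ∀ S ∈ Q, μ.real (Sep N S) * μ.real (Bd S e) = μ.real (Sep N S ∩ Bd S e) := by
      intro S _
      rw [Set.inter_comm, indep_of_depOn hμ (depOn_Bd S e) (depOn_sep N S)
        (witnessed_Bd S e).measurableSet (measurableSet_sep N S), mul_comm]
    rw [Finset.sum_congr rfl this, ← measureReal_biUnion_finset]
    · refine measureReal_mono (Set.iUnion₂_subset fun S hS => sep_inter_Bd ?_ e)
      exact (Finset.mem_filter.1 hS).2
    · exact hdisj.mono_on fun C _ => Set.inter_subset_left
    · exact fun S _ => (measurableSet_sep N S).inter (witnessed_Bd S e).measurableSet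
  have h3 : ∀ S ∈ Q, μ.real (Sep N S) ≤
      p * ∑ e ∈ touchF (boxF N), μ.real (Sep N S) * μ.real (Bd S e) := by
    intro S hS
    rw [hQ, Finset.mem_filter, Finset.mem_powerset] at hS
    have h4 : phi μ S ≤ ∑ e ∈ touchF (boxF N), μ.real (Bd S e) :=
      Finset.sum_le_sum_of_subset_of_nonneg (touchF_mono hS.1) fun _ _ _ => measureReal_nonneg
    have h5 := (hphi S hS.2).trans (mul_le_mul_of_nonneg_left h4 hp.1.le)
    rw [← Finset.mul_sum]
    have h6 := mul_le_mul_of_nonneg_left h5 (measureReal_nonneg (μ := μ) (s := Sep N S))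
    linarith
  have h7 : 1 - μ.real (Far N 0) = μ.real (Far N 0)ᶜ := by
    rw [probReal_compl_eq_one_sub (witnessed_far N 0).measurableSet]
  rw [h7]
  calc μ.real (Far N 0)ᶜ ≤ μ.real (⋃ S ∈ Q, Sep N S) := measureReal_mono h1 (measure_ne_top _ _)
    _ ≤ ∑ S ∈ Q, μ.real (Sep N S) := measureReal_biUnion_finset_le _ _
    _ ≤ ∑ S ∈ Q, p * ∑ e ∈ touchF (boxF N), μ.real (Sep N S) * μ.real (Bd S e) :=
        Finset.sum_le_sum h3
    _ = p * ∑ e ∈ touchF (boxF N), ∑ S ∈ Q, μ.real (Sep N S) * μ.real (Bd S e) := by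
        rw [← Finset.mul_sum, Finset.sum_comm]
    _ ≤ _ := mul_le_mul_of_nonneg_left (Finset.sum_le_sum h2) hp.1.le

end Russo

theorem theta_pos (P : ℝ → Measure PercConfig)
    (hP : ∀ p ∈ Set.Ioo (0 : ℝ) 1, IsProbabilityMeasure (P p) ∧ IsBernoulliProduct p (P p))
    {q : ℝ} (hq : q ∈ Set.Ioo (0 : ℝ) 1) (h : 1 / 2 < q) : 0 < P q {ω | ClusterInfinite ω} := by
  have hhalf : (1 / 2 : ℝ) ∈ Set.Ioo (0 : ℝ) 1 := by norm_num
  have hIcc : ∀ p ∈ Set.Icc (1 / 2) q, p ∈ Set.Ioo (0 : ℝ) 1 := fun p hp =>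
    ⟨hhalf.1.trans_le hp.1, hp.2.trans_lt hq.2⟩
  have hu : ∀ N, ∀ p ∈ Set.Icc (1 / 2) q,
      (P p).real (Far N 0) = Ew (touchF (boxF N)) p (ind (Far N 0)) := by
    intro N p hp
    have := (hP p (hIcc p hp)).1
    exact real_eq_Ew (hIcc p hp) (hP p (hIcc p hp)).2 (depOn_far N)
  have hphi : ∀ p ∈ Set.Icc (1 / 2) q, ∀ S : Finset (ℤ × ℤ), 0 ∈ S → 1 ≤ p * phi (P p) S := by
    intro p hp S hS
    have i1 := (hP p (hIcc p hp)).1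
    have i2 := (hP _ hhalf).1
    refine one_le_phi (hIcc p hp) (hP p (hIcc p hp)).2 (fun N => ?_) hS
    refine (one_le_far (hP _ hhalf).2 N).trans (mul_le_mul_of_nonneg_left ?_ (by positivity))
    exact real_far_mono hhalf (hIcc p hp) hp.1 (hP _ hhalf).2 (hP p (hIcc p hp)).2 N
  have hlow : ∀ N, 1 - Real.exp (-(q - 1 / 2)) ≤ (P q).real (Far N 0) := by
    intro N
    let g : ℝ → ℝ := fun p => Real.exp p * (1 - Ew (touchF (boxF N)) p (ind (Far N 0)))
    have hd : ∀ p ∈ Set.Icc (1 / 2) q, HasDerivAt g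
        (Real.exp p * (1 - Ew (touchF (boxF N)) p (ind (Far N 0))) +
          Real.exp p * (-((1 - p)⁻¹ * ∑ e ∈ touchF (boxF N), (P p).real (Piv N e)))) p := by
      intro p hp
      have i1 := (hP p (hIcc p hp)).1
      exact (Real.hasDerivAt_exp p).mul
        ((deriv_eq_piv (hIcc p hp) (hP p (hIcc p hp)).2 N).const_sub 1)
    have hanti : AntitoneOn g (Set.Icc (1 / 2) q) := by
      refine antitoneOn_of_deriv_nonpos (convex_Icc _ _)
        (fun p hp => (hd p hp).continuousAt.continuousWithinAt)
        (fun p hp => (hd p (interior_subset hp)).differentiableAt.differentiableWithinAt) fun p hp => ?_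
      have hp := interior_subset hp
      rw [(hd p hp).deriv, ← mul_add]
      refine mul_nonpos_of_nonneg_of_nonpos (Real.exp_pos _).le ?_
      have i1 := (hP p (hIcc p hp)).1
      have h1 := le_sum_piv (hIcc p hp) (hP p (hIcc p hp)).2 N (hphi p hp)
      rw [hu N p hp] at h1
      set sP := ∑ e ∈ touchF (boxF N), (P p).real (Piv N e)
      have hS : 0 ≤ sP := Finset.sum_nonneg fun _ _ => measureReal_nonneg
      have hp1 := hIcc p hp
      have h2 : 1 ≤ (1 - p)⁻¹ := (one_le_inv₀ (by linarith [hp1.2])).2 (by linarith [hp1.1])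
      have h3 := mul_le_mul_of_nonneg_right h2 hS
      have h4 := mul_le_mul_of_nonneg_right hp1.2.le hS
      linarith
    have h1 := hanti (Set.left_mem_Icc.2 h.le) (Set.right_mem_Icc.2 h.le) h.le
    simp only [g] at h1
    rw [← hu N q (Set.right_mem_Icc.2 h.le), ← hu N _ (Set.left_mem_Icc.2 h.le)] at h1
    have h2 : Real.exp (1 / 2) * (1 - (P (1 / 2)).real (Far N 0)) ≤ Real.exp (1 / 2) :=
      mul_le_of_le_one_right (Real.exp_pos _).le
        (by linarith [measureReal_nonneg (μ := P (1 / 2)) (s := Far N 0)])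
    have h3 : Real.exp (-(q - 1 / 2)) * Real.exp q = Real.exp (1 / 2) := by
      rw [← Real.exp_add]; congr 1; ring
    have h4 : (1 - (P q).real (Far N 0)) ≤ Real.exp (-(q - 1 / 2)) := by
      refine le_of_mul_le_mul_right ?_ (Real.exp_pos q)
      linarith
    linarith
  have i1 := (hP q hq).1
  have hset : {ω | ClusterInfinite ω} = ⋂ N, Far N 0 := by
    ext ω; simp [clusterInfinite_iff]
  have hlim := tendsto_measure_iInter_atTop (μ := P q)
    (fun N => (witnessed_far N 0).measurableSet.nullMeasurableSet) far_antitone ⟨0, measure_ne_top _ _⟩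
  rw [← hset] at hlim
  have hlim' := (ENNReal.tendsto_toReal (measure_ne_top _ _)).comp hlim
  have hge := ge_of_tendsto' hlim' hlow
  have hpos : 0 < 1 - Real.exp (-(q - 1 / 2)) := by
    have := Real.exp_lt_one_iff.2 (show -(q - 1 / 2) < 0 by linarith)
    linarith
  exact (ENNReal.toReal_pos_iff.1 (hpos.trans_le hge)).1


/-- The horizontal strip of half-width `h`. -/
def strip (h : ℕ) : Set (ℤ × ℤ) := {v | |v.2| < h}

section Duality

variable {ω : PercConfig} {h : ℕ}

theorem exists_height {a : ℤ} {d : ℤ × ℤ} (hd : Conn (dual ω) (touch (strip h)) (a, h) d) :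
    ∃ n : ℤ → ℤ → ℤ, (∀ x, n x h = 0) ∧
      (∀ x, n x (-h) = (if a < x then 1 else 0) - (if d.1 < x then 1 else 0)) ∧
      (∀ x y, ω (vE (x, y)) = true → n x (y + 1) = n x y) ∧
      (∀ x y : ℤ, -h < y → y < h → ω (hE (x, y)) = true →
        n (x + 1) y - n x y = (if a = x then 1 else 0) - (if d.1 = x ∧ y ≤ d.2 then 1 else 0)) := by
  induction hd with
  | refl =>
    refine ⟨fun _ _ => 0, fun _ => rfl, fun x => by simp, fun _ _ _ => rfl, fun x y _ hy _ => ?_⟩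
    simp [hy.le]
  | @tail d d' _ hs ih =>
    obtain ⟨n, h1, h2, h3, h4⟩ := ih
    obtain ⟨ho, ht⟩ := hs
    rw [mem_touch] at ht
    obtain ⟨c, b⟩ := d
    obtain ⟨c', b'⟩ := d'
    simp only [strip, Set.mem_ofPred_eq, abs_lt] at ht
    obtain h5 | h5 | h5 | h5 := ho.cases <;> simp only [Prod.mk.injEq] at h5 <;>
      obtain ⟨rfl, rfl⟩ := h5
    · have hcl : ω (vE (c + 1, b')) = false := by
        have := op_right.1 ho
        rwa [dual_hE, Bool.not_eq_true'] at this
      refine ⟨fun x y => n x y + if x = c + 1 ∧ y ≤ b' then 1 else 0, fun x => ?_, fun x => ?_,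
        fun x y hv => ?_, fun x y hy hy' hv => ?_⟩
      · have := h1 x; dsimp only; split_ifs <;> omega
      · have := h2 x; dsimp only at this ⊢; split_ifs at this ⊢ <;> omega
      · have := h3 x y hv
        have hne : ¬ (x = c + 1 ∧ y = b') := by
          rintro ⟨rfl, rfl⟩
          rw [hcl] at hv
          exact Bool.false_ne_true hv
        dsimp only; split_ifs <;> omega
      · have := h4 x y hy hy' hv
        dsimp only at this ⊢; split_ifs at this ⊢ <;> omega
    · have hcl : ω (vE (c' + 1, b)) = false := by
        have := op_right.1 ho.symm
        rwa [dual_hE, Bool.not_eq_true'] at this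
      refine ⟨fun x y => n x y - if x = c' + 1 ∧ y ≤ b then 1 else 0, fun x => ?_, fun x => ?_,
        fun x y hv => ?_, fun x y hy hy' hv => ?_⟩
      · have := h1 x; dsimp only; split_ifs <;> omega
      · have := h2 x; dsimp only at this ⊢; split_ifs at this ⊢ <;> omega
      · have := h3 x y hv
        have hne : ¬ (x = c' + 1 ∧ y = b) := by
          rintro ⟨rfl, rfl⟩
          rw [hcl] at hv
          exact Bool.false_ne_true hv
        dsimp only; split_ifs <;> omega
      · have := h4 x y hy hy' hv
        dsimp only at this ⊢; split_ifs at this ⊢ <;> omega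
    · have hcl : ω (hE (c', b + 1)) = false := by
        have := op_up.1 ho
        rwa [dual_vE, Bool.not_eq_true'] at this
      refine ⟨n, h1, h2, h3, fun x y hy hy' hv => ?_⟩
      have := h4 x y hy hy' hv
      have hne : ¬ (x = c' ∧ y = b + 1) := by
        rintro ⟨rfl, rfl⟩
        rw [hcl] at hv
        exact Bool.false_ne_true hv
      dsimp only at this ⊢; split_ifs at this ⊢ <;> omega
    · have hcl : ω (hE (c, b' + 1)) = false := by
        have := op_up.1 ho.symm
        rwa [dual_vE, Bool.not_eq_true'] at this
      refine ⟨n, h1, h2, h3, fun x y hy hy' hv => ?_⟩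
      have := h4 x y hy hy' hv
      have hne : ¬ (x = c ∧ y = b' + 1) := by
        rintro ⟨rfl, rfl⟩
        rw [hcl] at hv
        exact Bool.false_ne_true hv
      dsimp only at this ⊢; split_ifs at this ⊢ <;> omega

theorem dual_blocks {a b x y : ℤ} (hx : x ≤ a) (hy : b < y)
    (hd : Conn (dual ω) (touch (strip h)) (a, h) (b, -h)) :
    ¬ Conn ω (touch (strip h)) (x, h) (y, -h) := by
  intro hp
  obtain ⟨n, h1, h2, h3, h4⟩ := exists_height hd
  have key : ∀ v, Conn ω (touch (strip h)) (x, h) v →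
      n v.1 v.2 - (if a < v.1 then 1 else 0) = 0 := by
    intro v hv
    induction hv with
    | refl => have := h1 x; dsimp only; split_ifs <;> omega
    | @tail v w _ hs ih =>
      obtain ⟨ho, ht⟩ := hs
      rw [mem_touch] at ht
      obtain ⟨c, b⟩ := v
      obtain ⟨c', b'⟩ := w
      simp only [strip, Set.mem_ofPred_eq, abs_lt] at ht
      obtain h5 | h5 | h5 | h5 := ho.cases <;> simp only [Prod.mk.injEq] at h5 <;>
        obtain ⟨rfl, rfl⟩ := h5
      · have := h4 c b' (by omega) (by omega) (op_right.1 ho)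
        dsimp only at this ih ⊢; split_ifs at this ih ⊢ <;> omega
      · have := h4 c' b (by omega) (by omega) (op_right.1 ho.symm)
        dsimp only at this ih ⊢; split_ifs at this ih ⊢ <;> omega
      · have := h3 c' b (op_up.1 ho)
        dsimp only at this ih ⊢; split_ifs at this ih ⊢ <;> omega
      · have := h3 c b' (op_up.1 ho.symm)
        dsimp only at this ih ⊢; split_ifs at this ih ⊢ <;> omega
  have h6 := key _ hp
  have h7 := h2 y
  dsimp only at h6 h7
  split_ifs at h6 h7 <;> omega

end Duality


/-- The cluster of `v` leaves the strip of half-width `h`. -/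
def High (h : ℕ) (v : ℤ × ℤ) : Set PercConfig := {ω | ∃ y, y ∉ strip h ∧ Conn ω Set.univ v y}

/-- The cluster of `v` is vertically unbounded. -/
def Tall (v : ℤ × ℤ) : Set PercConfig := ⋂ h, High h v

theorem witnessed_high (h : ℕ) (v : ℤ × ℤ) : Witnessed (High h v) := by
  have : High h v = ⋃ y, ⋃ (_ : y ∉ strip h), {ω | Conn ω Set.univ v y} := by
    ext ω; simp [High]
  rw [this]
  exact Witnessed.iUnion fun y => Witnessed.iUnion fun _ => witnessed_conn _ _ _

theorem measurableSet_tall (v : ℤ × ℤ) : MeasurableSet (Tall v) :=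
  MeasurableSet.iInter fun h => (witnessed_high h v).measurableSet

theorem strip_mono {h k : ℕ} (hk : h ≤ k) : strip h ⊆ strip k := by
  intro v hv
  have : (h : ℤ) ≤ k := by exact_mod_cast hk
  exact lt_of_lt_of_le (show |v.2| < (h : ℤ) from hv) this

theorem high_antitone (v : ℤ × ℤ) : Antitone fun h => High h v :=
  fun _ _ hk _ ⟨y, hy, hc⟩ => ⟨y, fun h => hy (strip_mono hk h), hc⟩

theorem finite_mem_edge (e : Sym2 (ℤ × ℤ)) : {v | v ∈ e}.Finite := by
  induction e using Sym2.ind with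
  | _ a b =>
    refine (Set.toFinite {a, b}).subset fun v hv => ?_
    simpa [-Prod.forall] using hv

/-- Changing finitely many edges splits a cluster into finitely many pieces. -/
theorem exists_finite_cover (S : Finset LatticeEdge) (v : ℤ × ℤ) :
    ∃ W : Finset (ℤ × ℤ), ∀ ω ω' : PercConfig, (∀ e ∉ S, ω e = ω' e) →
      ∀ y, Conn ω Set.univ v y → ∃ u ∈ W, Conn ω' Set.univ u y := by
  have hf : (⋃ e ∈ S, {u | u ∈ e.1}).Finite :=
    S.finite_toSet.biUnion fun e _ => finite_mem_edge e.1
  refine ⟨insert v hf.toFinset, fun ω ω' hw y hy => ?_⟩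
  induction hy with
  | refl => exact ⟨v, Finset.mem_insert_self _ _, Conn.refl _ _ _⟩
  | @tail y z _ hs ih =>
    obtain ⟨u, hu, hc⟩ := ih
    obtain ⟨⟨hl, ho⟩, -⟩ := hs
    by_cases he : (⟨s(y, z), hl⟩ : LatticeEdge) ∈ S
    · refine ⟨z, Finset.mem_insert_of_mem ?_, Conn.refl _ _ _⟩
      rw [Set.Finite.mem_toFinset, Set.mem_iUnion₂]
      exact ⟨_, he, Sym2.mem_mk_right y z⟩
    · exact ⟨u, hu, hc.tail ⟨hl, (hw _ he).symm.trans ho⟩ (Set.mem_univ _)⟩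

theorem depOn_iUnion_tall (S : Finset LatticeEdge) :
    DepOn (⋃ v, Tall v) (Subtype.val '' (S : Set LatticeEdge))ᶜ := by
  intro ω ω' hw hω
  obtain ⟨v, hv⟩ := Set.mem_iUnion.1 hω
  obtain ⟨W, hW⟩ := exists_finite_cover S v
  have hw' : ∀ e ∉ S, ω e = ω' e := by
    refine fun e he => hw e ?_
    rintro ⟨e', he', h⟩
    exact he (Subtype.ext h ▸ he')
  by_contra hcon
  have hcon' : ∀ u, ∃ h, ω' ∉ High h u := by
    intro u
    by_contra h
    exact hcon (Set.mem_iUnion.2 ⟨u, Set.mem_iInter.2 fun k => by_contra fun hk => h ⟨k, hk⟩⟩)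
  choose k hk using hcon'
  obtain ⟨y, hy, hc⟩ := Set.mem_iInter.1 hv (W.sup k)
  obtain ⟨u, hu, hc'⟩ := hW ω ω' hw' y hc
  exact hk u (high_antitone u (Finset.le_sup hu) ⟨y, hy, hc'⟩)

section Half

variable {μ : Measure PercConfig} [IsProbabilityMeasure μ]

/-- A zero-one law: an event which is insensitive to finitely many edges is trivial. -/
theorem real_eq_one_of_tail {p : ℝ} (hμ : IsBernoulliProduct p μ) {E : Set PercConfig}
    (mE : MeasurableSet E)
    (hE : ∀ S : Finset LatticeEdge, DepOn E (Subtype.val '' (S : Set LatticeEdge))ᶜ)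
    (h0 : μ E ≠ 0) : μ.real E = 1 := by
  have hν : IsBernoulliProduct p (ProbabilityTheory.cond μ E) := by
    intro S b
    rw [ProbabilityTheory.cond_apply mE, ← hμ S b]
    have hind := indep_of_depOn hμ
      (depOn_cyl S b (D := Subtype.val '' (S : Set LatticeEdge)) fun e he => ⟨e, he, rfl⟩) (hE S)
      (measurableSet_cyl S b) mE
    have h1 : μ (cyl S b ∩ E) = μ (cyl S b) * μ E := by
      rw [← ENNReal.toReal_eq_toReal_iff' (measure_ne_top _ _)
        (ENNReal.mul_ne_top (measure_ne_top _ _) (measure_ne_top _ _)), ENNReal.toReal_mul]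
      exact hind
    rw [Set.inter_comm]
    refine (congrArg _ h1).trans ?_
    rw [mul_comm (μ (cyl S b)), ← mul_assoc, ENNReal.inv_mul_cancel h0 (measure_ne_top _ _), one_mul]
    rfl
  have := ProbabilityTheory.cond_isProbabilityMeasure h0
  have heq := bernoulli_unique hμ hν
  have h2 : μ E = 1 := by
    rw [heq, ProbabilityTheory.cond_apply mE, Set.inter_self,
      ENNReal.inv_mul_cancel h0 (measure_ne_top _ _)]
  rw [measureReal_def, h2, ENNReal.toReal_one]

theorem real_tall_ne_zero {p : ℝ} (hμ : IsBernoulliProduct p μ)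
    (h : μ {ω | ClusterInfinite ω} ≠ 0) : μ (Tall 0) ≠ 0 := by
  intro h0
  have hsw : μ {ω | relabel (edgeMap (Equiv.prodComm ℤ ℤ) swap_edge) ω ∈ Tall 0} = 0 := by
    rw [← measureReal_eq_zero_iff, real_relabel hμ _ (measurableSet_tall 0), measureReal_def, h0,
      ENNReal.toReal_zero]
  refine h (measure_mono_null ?_ (measure_union_null h0 hsw))
  intro ω hω
  by_contra hcon
  rw [Set.mem_union, not_or] at hcon
  obtain ⟨h1, h2⟩ := hcon
  simp only [Tall, Set.mem_iInter, Set.mem_ofPred_eq, not_forall] at h1 h2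
  obtain ⟨k, hk⟩ := h1
  obtain ⟨l, hl⟩ := h2
  obtain ⟨y, hy, hc⟩ := clusterInfinite_iff.1 hω (k + l)
  rw [sub_zero] at hy
  have hk' : y ∈ strip k := by
    by_contra hcon
    exact hk ⟨y, hcon, hc⟩
  have hl' : y.swap ∈ strip l := by
    by_contra hcon
    refine hl ⟨y.swap, hcon, ?_⟩
    have := conn_relabel (τ := Equiv.prodComm ℤ ℤ) (hτ := swap_edge) (ω := ω) (D := Set.univ)
      (u := 0) (v := y.swap)
    rw [Set.preimage_univ] at this
    exact this.2 hc
  refine hy ⟨?_, ?_⟩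
  · have : |y.1| < l := hl'
    push_cast; omega
  · have : |y.2| < k := hk'
    push_cast; omega

theorem exists_box_tall {p : ℝ} (hμ : IsBernoulliProduct p μ)
    (h : μ {ω | ClusterInfinite ω} ≠ 0) {ε : ℝ} (hε : 0 < ε) :
    ∃ n : ℕ, ∀ h, 1 - ε < μ.real (⋃ v ∈ box n, High h v) := by
  have h1 : μ.real (⋃ v, Tall v) = 1 := by
    refine real_eq_one_of_tail hμ (MeasurableSet.iUnion measurableSet_tall) depOn_iUnion_tall ?_
    exact fun h0 => real_tall_ne_zero hμ h (measure_mono_null (Set.subset_iUnion _ _) h0)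
  have hmono : Monotone fun n : ℕ => ⋃ v ∈ box n, Tall v := by
    intro n m hnm
    refine Set.biUnion_subset_biUnion_left fun v hv => ?_
    have : (n : ℤ) ≤ m := by exact_mod_cast hnm
    exact ⟨hv.1.trans this, hv.2.trans this⟩
  have hU : ⋃ n : ℕ, ⋃ v ∈ box n, Tall v = ⋃ v, Tall v := by
    refine Set.Subset.antisymm (Set.iUnion_subset fun n => Set.iUnion₂_subset fun v _ =>
      Set.subset_iUnion _ v) (Set.iUnion_subset fun v => ?_)
    obtain ⟨n, hn⟩ := exists_box (Set.finite_singleton v)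
    exact (Set.subset_biUnion_of_mem (u := fun v => Tall v) (hn rfl)).trans
      (Set.subset_iUnion (fun n : ℕ => ⋃ v ∈ box n, Tall v) n)
  have hlim := tendsto_measure_iUnion_atTop (μ := μ) hmono
  rw [hU] at hlim
  have hlim' := (ENNReal.tendsto_toReal (measure_ne_top _ _)).comp hlim
  obtain ⟨n, hn⟩ := (hlim'.eventually (lt_mem_nhds (show 1 - ε < (μ (⋃ v, Tall v)).toReal by
    rw [← measureReal_def, h1]; linarith))).exists
  refine ⟨n, fun k => lt_of_lt_of_le hn (measureReal_mono ?_ (measure_ne_top _ _))⟩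
  exact Set.iUnion₂_mono fun v _ => Set.iInter_subset _ k

end Half


theorem box_subset_strip {n h : ℕ} (hn : n < h) : box n ⊆ strip h := by
  rintro v ⟨_, h2⟩
  show |v.2| < (h : ℤ)
  omega

theorem arm_strip {n h : ℕ} (hn : n < h) :
    Arm (box n) (strip h) (strip h)ᶜ = ⋃ v ∈ box n, High h v := by
  ext ω
  rw [exists_conn_touch (box_subset_strip hn)]
  simp only [High, Set.mem_iUnion, exists_prop, Set.mem_ofPred_eq]

theorem Conn.level_le {ω : PercConfig} {h : ℕ} {u v : ℤ × ℤ} (hc : Conn ω (touch (strip h)) u v)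
    (hu : u ∈ strip h) : |v.2| ≤ h := by
  induction hc with
  | refl => exact le_of_lt hu
  | @tail v w _ hs _ =>
    obtain ⟨ho, ht⟩ := hs
    rw [mem_touch] at ht
    simp only [strip, Set.mem_ofPred_eq, abs_lt] at ht
    rw [abs_le]
    obtain h5 | h5 | h5 | h5 := ho.cases <;> rw [Prod.ext_iff] at h5 <;> dsimp only at h5 <;> omega

/-- The edges leaving the closed strip near the central part of its boundary. -/
noncomputable def capEdges (m h : ℕ) : Finset LatticeEdge :=
  (Finset.Icc (-(m : ℤ) - 1) m).biUnion fun x =>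
    {hE (x, (h : ℤ)), hE (x, -(h : ℤ)), vE (x, (h : ℤ)), vE (x, -(h : ℤ) - 1)}

theorem card_capEdges (m h : ℕ) : (capEdges m h).card ≤ (2 * m + 2) * 4 := by
  have h1 : (Finset.Icc (-(m : ℤ) - 1) m).card = 2 * m + 2 := by
    rw [Int.card_Icc]; omega
  rw [← h1]
  exact Finset.card_biUnion_le_card_mul _ _ _ fun x _ => Finset.card_le_four

theorem mem_capEdges {m h : ℕ} {x : ℤ} (h1 : -(m : ℤ) - 1 ≤ x) (h2 : x ≤ m) {e : LatticeEdge}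
    (he : e = hE (x, (h : ℤ)) ∨ e = hE (x, -(h : ℤ)) ∨ e = vE (x, (h : ℤ)) ∨
      e = vE (x, -(h : ℤ) - 1)) : e ∈ capEdges m h := by
  rw [capEdges, Finset.mem_biUnion]
  exact ⟨x, Finset.mem_Icc.2 ⟨h1, h2⟩, by simpa using he⟩

/-- Vertices far from the vertical axis. -/
def wide (m : ℕ) : Set (ℤ × ℤ) := {v | (m : ℤ) < |v.1|}

theorem capEdges_not_touch (m h : ℕ) : ∀ e ∈ capEdges m h, e.1 ∈ (touch (strip h))ᶜ := by
  intro e he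
  rw [capEdges, Finset.mem_biUnion] at he
  obtain ⟨x, -, he⟩ := he
  simp only [Finset.mem_insert, Finset.mem_singleton] at he
  obtain rfl | rfl | rfl | rfl := he <;>
    simp only [hE, vE, Set.mem_compl_iff, mem_touch, strip, Set.mem_ofPred_eq,
      abs_lt] <;> omega

theorem cap_blocks {n m h : ℕ} (hn : n < h) :
    (⋃ v ∈ box n, High h v) \ Arm (box n) (strip h) ((strip h)ᶜ ∩ wide m) ∩
      cyl (capEdges m h) (fun _ => false) ⊆
    (⋃ v ∈ box n, High h v) \ ⋃ v ∈ box n, High (h + 1) v := by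
  rintro ω ⟨⟨h1, h2⟩, hcl⟩
  refine ⟨h1, fun h3 => ?_⟩
  obtain ⟨v, hv, y, hy, hc⟩ := Set.mem_iUnion₂.1 h3
  have hvs := box_subset_strip hn hv
  have hy' : y ∉ {w | Conn ω (touch (strip h)) v w} := by
    intro hw
    have := Conn.level_le hw hvs
    refine hy ?_
    show |y.2| < ((h + 1 : ℕ) : ℤ)
    push_cast; omega
  obtain ⟨a, ha, b, hb, -, ho, -, -⟩ := hc.exit (Conn.refl _ _ _) hy'
  have hab : s(a, b) ∉ touch (strip h) := fun ht => hb (Conn.tail ha ho ht)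
  rw [mem_touch, not_or] at hab
  have haw : a ∉ wide m := fun haw => h2 ⟨v, hv, a, ⟨hab.1, haw⟩, ha⟩
  have hal := Conn.level_le ha hvs
  obtain ⟨x, z⟩ := a
  obtain ⟨x', z'⟩ := b
  simp only [strip, wide, Set.mem_ofPred_eq, abs_lt, lt_abs, abs_le] at hab haw hal
  have hclosed : ∀ e ∈ capEdges m h, ω e ≠ true := fun e he => by simp [hcl e he]
  have hz : z = h ∨ z = -h := by omega
  obtain h5 | h5 | h5 | h5 := ho.cases <;> simp only [Prod.mk.injEq] at h5 <;>
    obtain ⟨rfl, rfl⟩ := h5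
  · refine hclosed _ ?_ (op_right.1 ho)
    obtain rfl | rfl := hz
    · exact mem_capEdges (by omega) (by omega) (Or.inl rfl)
    · exact mem_capEdges (by omega) (by omega) (Or.inr (Or.inl rfl))
  · refine hclosed _ ?_ (op_right.1 ho.symm)
    obtain rfl | rfl := hz
    · exact mem_capEdges (by omega) (by omega) (Or.inl rfl)
    · exact mem_capEdges (by omega) (by omega) (Or.inr (Or.inl rfl))
  · refine hclosed _ ?_ (op_up.1 ho)
    obtain rfl : z = h := by omega
    exact mem_capEdges (by omega) (by omega) (Or.inr (Or.inr (Or.inl rfl)))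
  · refine hclosed _ ?_ (op_up.1 ho.symm)
    obtain rfl : z' = -(h : ℤ) - 1 := by omega
    exact mem_capEdges (by omega) (by omega) (Or.inr (Or.inr (Or.inr rfl)))

theorem arm_union (X U Y Y' : Set (ℤ × ℤ)) : Arm X U (Y ∪ Y') = Arm X U Y ∪ Arm X U Y' := by
  ext ω
  constructor
  · rintro ⟨u, hu, y, hy | hy, hc⟩
    exacts [Or.inl ⟨u, hu, y, hy, hc⟩, Or.inr ⟨u, hu, y, hy, hc⟩]
  · rintro (⟨u, hu, y, hy, hc⟩ | ⟨u, hu, y, hy, hc⟩)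
    exacts [⟨u, hu, y, Or.inl hy, hc⟩, ⟨u, hu, y, Or.inr hy, hc⟩]

theorem half_mem : (1 / 2 : ℝ) ∈ Set.Ioo (0 : ℝ) 1 := by norm_num

theorem real_cyl_half {μ : Measure PercConfig} (hμ : IsBernoulliProduct (1 / 2) μ)
    (S : Finset LatticeEdge) (b : PercConfig) :
    μ.real (cyl S b) = (1 / 2) ^ S.card := by
  rw [real_cyl half_mem hμ, ← Finset.prod_const]
  exact Finset.prod_congr rfl fun e _ => by split_ifs <;> norm_num

section Half

variable {μ : Measure PercConfig} [IsProbabilityMeasure μ]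

/-- With high probability a large box reaches the boundary of a wide strip far from its centre. -/
theorem exists_wide_arm (hμ : IsBernoulliProduct (1 / 2) μ) {n : ℕ} {ε : ℝ} (hε : 0 < ε)
    (hn : ∀ h, 1 - ε < μ.real (⋃ v ∈ box n, High h v)) (m h₀ : ℕ) :
    ∃ h, h₀ ≤ h ∧ 1 - 2 * ε < μ.real (Arm (box n) (strip h) ((strip h)ᶜ ∩ wide m)) := by
  set e : ℕ → ℝ := fun h => μ.real (⋃ v ∈ box n, High h v) with he
  have hsub : ∀ h, (⋃ v ∈ box n, High (h + 1) v) ⊆ ⋃ v ∈ box n, High h v := fun h =>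
    Set.iUnion₂_mono fun v _ => high_antitone v h.le_succ
  have hanti : Antitone e := antitone_nat_of_succ_le fun h =>
    measureReal_mono (hsub h) (measure_ne_top _ _)
  have hlim := tendsto_atTop_ciInf hanti ⟨0, by rintro _ ⟨h, rfl⟩; exact measureReal_nonneg⟩
  have hdiff := hlim.sub (hlim.comp (Filter.tendsto_add_atTop_nat 1))
  rw [sub_self] at hdiff
  have hδ : 0 < ε * (1 / 2 : ℝ) ^ ((2 * m + 2) * 4) := by positivity
  obtain ⟨h, h1, h2⟩ := ((hdiff.eventually (gt_mem_nhds hδ)).and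
    (Filter.eventually_ge_atTop (max h₀ (n + 1)))).exists
  refine ⟨h, le_trans (le_max_left _ _) h2, ?_⟩
  have hnh : n < h := lt_of_lt_of_le n.lt_succ_self (le_trans (le_max_right _ _) h2)
  have hwit : ∀ h, MeasurableSet (⋃ v ∈ box n, High h v) := fun h =>
    (Witnessed.iUnion fun v => Witnessed.iUnion fun _ => witnessed_high h v).measurableSet
  set B := Arm (box n) (strip h) ((strip h)ᶜ ∩ wide m) with hB
  have hBE : B ⊆ ⋃ v ∈ box n, High h v := by
    rw [← arm_strip hnh]
    exact Arm.mono subset_rfl subset_rfl Set.inter_subset_left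
  have mB : MeasurableSet B := (witnessed_arm _ _ _).measurableSet
  have hdep : DepOn ((⋃ v ∈ box n, High h v) \ B) (touch (strip h)) := by
    rw [← arm_strip hnh]
    exact (depOn_arm _ _ _).inter (depOn_arm _ _ _).compl
  have hind := indep_of_depOn hμ hdep
    (depOn_cyl (capEdges m h) (fun _ => false) (capEdges_not_touch m h))
    ((hwit h).diff mB) (measurableSet_cyl _ _)
  have h3 := measureReal_mono (μ := μ) (cap_blocks (m := m) hnh) (measure_ne_top _ _)
  rw [hind, measureReal_sdiff (hsub h) (hwit _) (measure_ne_top _ _),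
    measureReal_sdiff hBE mB (measure_ne_top _ _), real_cyl_half hμ] at h3
  have h4 : (1 / 2 : ℝ) ^ ((2 * m + 2) * 4) ≤ (1 / 2) ^ (capEdges m h).card :=
    pow_le_pow_of_le_one (by norm_num) (by norm_num) (card_capEdges m h)
  have h5 : 0 ≤ μ.real (⋃ v ∈ box n, High h v) - μ.real B := 
    sub_nonneg.2 (measureReal_mono hBE (measure_ne_top _ _))
  have h6 := (mul_le_mul_of_nonneg_left h4 h5).trans (h3.trans h1.le)
  have h7 := le_of_mul_le_mul_right h6 (by positivity)
  have := hn h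
  linarith

/-- One of the four far boundary arcs of a strip. -/
def arc (h m : ℕ) (s t : ℤ) : Set (ℤ × ℤ) := {v | (m : ℤ) < s * v.1 ∧ (h : ℤ) ≤ t * v.2}

theorem one_sub_arm_union (hμ : IsBernoulliProduct (1 / 2) μ) (X U Y Y' : Set (ℤ × ℤ)) :
    (1 - μ.real (Arm X U Y)) * (1 - μ.real (Arm X U Y')) ≤ 1 - μ.real (Arm X U (Y ∪ Y')) := by
  have h1 := harris half_mem hμ (witnessed_arm X U Y) (witnessed_arm X U Y')
  have h2 := measureReal_union_add_inter (μ := μ) (s := Arm X U Y)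
    (witnessed_arm X U Y').measurableSet
  rw [arm_union]
  linarith

theorem real_arm_arc (hμ : IsBernoulliProduct (1 / 2) μ) (n h m : ℕ) {s t : ℤ}
    (hs : s = 1 ∨ s = -1) (ht : t = 1 ∨ t = -1) :
    μ.real (Arm (box n) (strip h) (arc h m s t)) = μ.real (Arm (box n) (strip h) (arc h m 1 1)) := by
  have hX : ∀ t, μ.real (Arm (box n) (strip h) (arc h m (-1) t)) =
      μ.real (Arm (box n) (strip h) (arc h m 1 t)) := by
    intro t
    rw [← real_arm_preimage hμ reflX_edge (box n) (strip h) (arc h m 1 t)]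
    congr 2 <;> ext v <;> simp [reflX, box, arc]
  have hY : μ.real (Arm (box n) (strip h) (arc h m 1 (-1))) =
      μ.real (Arm (box n) (strip h) (arc h m 1 1)) := by
    rw [← real_arm_preimage hμ (reflY_edge 0) (box n) (strip h) (arc h m 1 1)]
    congr 2 <;> ext v <;> simp [reflY, box, strip, arc]
  obtain rfl | rfl := hs <;> obtain rfl | rfl := ht
  · rfl
  · exact hY
  · exact hX 1
  · exact (hX _).trans hY

theorem arc_arm_large (hμ : IsBernoulliProduct (1 / 2) μ) {n h m : ℕ}
    (hw : 1 - 1 / 4096 < μ.real (Arm (box n) (strip h) ((strip h)ᶜ ∩ wide m))) {s t : ℤ}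
    (hs : s = 1 ∨ s = -1) (ht : t = 1 ∨ t = -1) :
    7 / 8 < μ.real (Arm (box n) (strip h) (arc h m s t)) := by
  rw [real_arm_arc hμ n h m hs ht]
  have hset : (strip h)ᶜ ∩ wide m =
      (arc h m 1 1 ∪ arc h m (-1) 1) ∪ (arc h m 1 (-1) ∪ arc h m (-1) (-1)) := by
    ext v
    simp only [strip, wide, arc, Set.mem_inter_iff, Set.mem_compl_iff, Set.mem_ofPred_eq,
      Set.mem_union, one_mul, neg_mul, abs_lt, lt_abs]
    omega
  rw [hset] at hw
  set a := μ.real (Arm (box n) (strip h) (arc h m 1 1)) with ha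
  have ha1 : a ≤ 1 := measureReal_le_one
  have h1 := one_sub_arm_union hμ (box n) (strip h) (arc h m 1 1) (arc h m (-1) 1)
  have h2 := one_sub_arm_union hμ (box n) (strip h) (arc h m 1 (-1)) (arc h m (-1) (-1))
  have h3 := one_sub_arm_union hμ (box n) (strip h) (arc h m 1 1 ∪ arc h m (-1) 1)
    (arc h m 1 (-1) ∪ arc h m (-1) (-1))
  rw [real_arm_arc hμ n h m (Or.inr rfl) (Or.inl rfl)] at h1
  rw [real_arm_arc hμ n h m (Or.inr rfl) (Or.inr rfl),
    real_arm_arc hμ n h m (Or.inl rfl) (Or.inr rfl)] at h2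
  have h4 := mul_le_mul h1 h2 (mul_self_nonneg (1 - a)) ((mul_self_nonneg (1 - a)).trans h1)
  by_contra hcon
  have h5 : 1 / 8 ≤ 1 - a := by linarith [not_lt.1 hcon]
  have h6 : (1 / 8 : ℝ) * (1 / 8) ≤ (1 - a) * (1 - a) :=
    mul_le_mul h5 h5 (by norm_num) (by linarith)
  have h7 := mul_le_mul h6 h6 (by norm_num) (mul_self_nonneg (1 - a))
  linarith

end Half


/-- The box of radius `n` centred at `(c, 0)`. -/
def boxAt (n : ℕ) (c : ℤ) : Set (ℤ × ℤ) := {v | |v.1 - c| ≤ n ∧ |v.2| ≤ n}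

/-- The edges whose lower left endpoint lies in the box of radius `n` centred at `(c, 0)`. -/
noncomputable def boxEdges (n : ℕ) (c : ℤ) : Finset LatticeEdge :=
  ((Finset.Icc (c - n) (c + n) ×ˢ Finset.Icc (-(n : ℤ)) n) ×ˢ Finset.univ).image toEdge

theorem card_boxEdges (n : ℕ) (c : ℤ) : (boxEdges n c).card = (boxEdges n 0).card := by
  simp only [boxEdges, Finset.card_image_of_injective _ toEdge_bijective.1, Finset.card_product,
    Int.card_Icc]
  congr 3
  omega

theorem hE_mem_boxEdges {n : ℕ} {c : ℤ} {v : ℤ × ℤ} (hv : v ∈ boxAt n c) : hE v ∈ boxEdges n c := by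
  obtain ⟨h1, h2⟩ := hv
  rw [abs_le] at h1 h2
  refine Finset.mem_image.2 ⟨(v, false), ?_, rfl⟩
  simp only [Finset.mem_product, Finset.mem_Icc]
  exact ⟨⟨⟨by omega, by omega⟩, by omega, by omega⟩, Finset.mem_univ _⟩

theorem vE_mem_boxEdges {n : ℕ} {c : ℤ} {v : ℤ × ℤ} (hv : v ∈ boxAt n c) : vE v ∈ boxEdges n c := by
  obtain ⟨h1, h2⟩ := hv
  rw [abs_le] at h1 h2
  refine Finset.mem_image.2 ⟨(v, true), ?_, rfl⟩
  simp only [Finset.mem_product, Finset.mem_Icc]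
  exact ⟨⟨⟨by omega, by omega⟩, by omega, by omega⟩, Finset.mem_univ _⟩

/-- Edges in a vertical column around `c`. -/
def column (n : ℕ) (c : ℤ) : Set (Sym2 (ℤ × ℤ)) := inside {v | |v.1 - c| ≤ n + 2}

theorem boxEdges_column {n : ℕ} {c : ℤ} {e : LatticeEdge} (he : e ∈ boxEdges n c) :
    e.1 ∈ column n c ∧ (cross e).1 ∈ column n c := by
  obtain ⟨⟨⟨x, y⟩, b⟩, h, rfl⟩ := Finset.mem_image.1 he
  simp only [Finset.mem_product, Finset.mem_Icc] at h
  cases b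
  · change (hE (x, y)).1 ∈ _ ∧ (cross (hE (x, y))).1 ∈ _
    rw [cross_hE]
    simp only [column, hE, vE, mem_inside, Set.mem_ofPred_eq, abs_le]
    omega
  · change (vE (x, y)).1 ∈ _ ∧ (cross (vE (x, y))).1 ∈ _
    rw [cross_vE]
    simp only [column, hE, vE, mem_inside, Set.mem_ofPred_eq, abs_le]
    omega

theorem column_disjoint {n : ℕ} {c c' : ℤ} (h : 2 * n + 5 ≤ |c - c'|) :
    column n c' ⊆ (column n c)ᶜ := by
  intro e h1 h2
  induction e using Sym2.ind with
  | _ u v =>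
    have h3 := (mem_inside.1 h1).1
    have h4 := (mem_inside.1 h2).1
    simp only [Set.mem_ofPred_eq, abs_le, le_abs] at h h3 h4
    omega

/-- All edges of a box are open. -/
def Full (n : ℕ) (c : ℤ) : Set PercConfig := cyl (boxEdges n c) fun _ => true

/-- All dual edges of a box are open. -/
def DualFull (n : ℕ) (c : ℤ) : Set PercConfig := cyl ((boxEdges n c).map cross.toEmbedding) fun _ => false

theorem dualFull_eq (n : ℕ) (c : ℤ) : DualFull n c = {ω | dual ω ∈ Full n c} := by
  ext ω
  simp [DualFull, Full, cyl, dual, flipRelabel]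
  exact ⟨fun h e he => h _ (by simpa using he), fun h e he => by simpa using h _ he⟩

theorem depOn_full (n : ℕ) (c : ℤ) : DepOn (Full n c) (column n c) :=
  depOn_cyl _ _ fun _ he => (boxEdges_column he).1

theorem depOn_dualFull (n : ℕ) (c : ℤ) : DepOn (DualFull n c) (column n c) := by
  refine depOn_cyl _ _ fun e he => ?_
  obtain ⟨e', he', rfl⟩ := Finset.mem_map.1 he
  exact (boxEdges_column he').2

theorem conn_of_full {n : ℕ} {c : ℤ} {ω : PercConfig} (hω : ω ∈ Full n c) {v : ℤ × ℤ}
    (hv : v ∈ boxAt n c) : Conn ω (touch (boxAt n c)) (c - n, -n) v := by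
  obtain ⟨x, y⟩ := v
  obtain ⟨h1, h2⟩ := hv
  dsimp only at h1 h2
  rw [abs_le] at h1 h2
  have hh : ∀ k : ℕ, k ≤ 2 * n →
      Conn ω (touch (boxAt n c)) (c - n, -n) (c - n + k, -n) := by
    intro k
    induction k with
    | zero => intro _; simpa using Conn.refl _ _ _
    | succ k ih =>
      intro hk
      have hm : ((c - n + k, -n) : ℤ × ℤ) ∈ boxAt n c := by
        constructor <;> dsimp only <;> rw [abs_le] <;> omega
      have h3 := (ih (by omega)).tail (op_right.2 (hω _ (hE_mem_boxEdges hm)))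
        (mem_touch.2 (Or.inl hm))
      rwa [add_assoc, ← Nat.cast_succ] at h3
  have hv : ∀ k : ℕ, k ≤ 2 * n → Conn ω (touch (boxAt n c)) (x, -n) (x, -n + k) := by
    intro k
    induction k with
    | zero => intro _; simpa using Conn.refl _ _ _
    | succ k ih =>
      intro hk
      have hm : ((x, -n + k) : ℤ × ℤ) ∈ boxAt n c := by
        constructor <;> dsimp only <;> rw [abs_le] <;> omega
      have h3 := (ih (by omega)).tail (op_up.2 (hω _ (vE_mem_boxEdges hm)))
        (mem_touch.2 (Or.inl hm))
      rwa [add_assoc, ← Nat.cast_succ] at h3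
  have h3 := hh (x - (c - n)).toNat (by omega)
  have h4 := hv (y + n).toNat (by omega)
  rw [show c - n + ((x - (c - n)).toNat : ℤ) = x by omega] at h3
  rw [show -n + ((y + n).toNat : ℤ) = y by omega] at h4
  exact h3.trans h4

theorem full_inter_arms {n : ℕ} {c : ℤ} {U Y Y' : Set (ℤ × ℤ)} (hU : boxAt n c ⊆ U) :
    Full n c ∩ (Arm (boxAt n c) U Y ∩ Arm (boxAt n c) U Y') ⊆ Arm Y U Y' := by
  rintro ω ⟨hf, ⟨u, hu, y, hy, h1⟩, v, hv, z, hz, h2⟩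
  refine ⟨y, hy, z, hz, (h1.symm.trans ?_).trans h2⟩
  exact ((conn_of_full hf hu).symm.trans (conn_of_full hf hv)).mono_set (touch_mono hU)

theorem Conn.level {ω : PercConfig} {h : ℕ} {u v : ℤ × ℤ} (hc : Conn ω (touch (strip h)) u v) :
    u = v ∨ |u.2| ≤ h ∧ |v.2| ≤ h := by
  induction hc with
  | refl => exact Or.inl rfl
  | @tail v w _ hs ih =>
    have key : |v.2| ≤ h ∧ |w.2| ≤ h := by
      obtain ⟨ho, ht⟩ := hs
      rw [mem_touch] at ht
      simp only [strip, Set.mem_ofPred_eq, abs_lt] at ht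
      simp only [abs_le]
      obtain h5 | h5 | h5 | h5 := ho.cases <;> rw [Prod.ext_iff] at h5 <;> dsimp only at h5 <;> omega
    obtain rfl | ih := ih
    · exact Or.inr key
    · exact Or.inr ⟨ih.1, key.2⟩

/-- Diagonal crossings of a strip and of its dual exclude each other. -/
theorem not_dual_crossing {h : ℕ} {ω : PercConfig}
    (hω : ω ∈ Arm (arc h 0 (-1) 1) (strip h) (arc h 0 1 (-1))) :
    dual ω ∉ Arm (arc h 0 1 1) (strip h) (arc h 0 (-1) (-1)) := by
  rintro ⟨⟨a, a'⟩, ha, ⟨b, b'⟩, hb, hd⟩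
  obtain ⟨⟨x, x'⟩, hx, ⟨y, y'⟩, hy, hc⟩ := hω
  have h1 := hd.level
  have h2 := hc.level
  simp only [arc, Set.mem_ofPred_eq, Prod.mk.injEq, abs_le] at ha hb hx hy h1 h2
  obtain rfl : a' = h := by omega
  obtain rfl : b' = -h := by omega
  obtain rfl : x' = h := by omega
  obtain rfl : y' = -h := by omega
  exact dual_blocks (by omega) (by omega) hd hc

section Half

variable {μ : Measure PercConfig}

theorem real_full (hμ : IsBernoulliProduct (1 / 2) μ) (n : ℕ) (c : ℤ) :
    μ.real (Full n c) = (1 / 2) ^ (boxEdges n 0).card := by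
  rw [Full, real_cyl_half hμ, card_boxEdges]

theorem real_dualFull (hμ : IsBernoulliProduct (1 / 2) μ) (n : ℕ) (c : ℤ) :
    μ.real (DualFull n c) = (1 / 2) ^ (boxEdges n 0).card := by
  rw [DualFull, real_cyl_half hμ, Finset.card_map, card_boxEdges]

variable [IsProbabilityMeasure μ]

theorem boxAt_arm_large (hμ : IsBernoulliProduct (1 / 2) μ) {n h m : ℕ} {c : ℤ} (hc : |c| ≤ m)
    (hw : 1 - 1 / 4096 < μ.real (Arm (box n) (strip h) ((strip h)ᶜ ∩ wide m))) {s t : ℤ}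
    (hs : s = 1 ∨ s = -1) (ht : t = 1 ∨ t = -1) :
    7 / 8 < μ.real (Arm (boxAt n c) (strip h) (arc h 0 s t)) := by
  have h1 := arc_arm_large hμ hw hs ht
  rw [← real_arm_preimage hμ (shift_edge (-c, 0))] at h1
  refine h1.trans_le (measureReal_mono (Arm.mono ?_ ?_ ?_) (measure_ne_top _ _))
  · intro v hv
    simpa [shift, box, boxAt, sub_eq_add_neg] using hv
  · intro v hv
    simpa [shift, strip] using hv
  · intro v hv
    rw [abs_le] at hc
    simp only [shift, arc, Set.mem_preimage, Equiv.coe_addRight, Set.mem_ofPred_eq, Prod.fst_add,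
      Prod.snd_add, add_zero] at hv ⊢
    obtain rfl | rfl := hs <;> refine ⟨?_, hv.2⟩ <;> have := hv.1 <;> push_cast at this ⊢ <;> linarith

theorem full_inter_crossing (hμ : IsBernoulliProduct (1 / 2) μ) {n h m : ℕ} (hn : n < h) {c : ℤ}
    (hc : |c| ≤ m)
    (hw : 1 - 1 / 4096 < μ.real (Arm (box n) (strip h) ((strip h)ᶜ ∩ wide m))) {s t s' t' : ℤ}
    (hs : s = 1 ∨ s = -1) (ht : t = 1 ∨ t = -1) (hs' : s' = 1 ∨ s' = -1) (ht' : t' = 1 ∨ t' = -1) :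
    3 / 4 * μ.real (Full n c) ≤ μ.real (Full n c ∩ Arm (arc h 0 s t) (strip h) (arc h 0 s' t')) := by
  have h1 := boxAt_arm_large hμ hc hw hs ht
  have h2 := boxAt_arm_large hμ hc hw hs' ht'
  have hwit := (witnessed_arm (boxAt n c) (strip h) (arc h 0 s t)).inter
    (witnessed_arm (boxAt n c) (strip h) (arc h 0 s' t'))
  have h3 := harris half_mem hμ (witnessed_arm (boxAt n c) (strip h) (arc h 0 s t))
    (witnessed_arm (boxAt n c) (strip h) (arc h 0 s' t'))
  have h4 := harris half_mem hμ (witnessed_open (boxEdges n c)) hwit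
  have h5 : (7 / 8 : ℝ) * (7 / 8) ≤ _ := mul_le_mul h1.le h2.le (by norm_num) measureReal_nonneg
  have hU : boxAt n c ⊆ strip h := by
    rintro v ⟨_, hv⟩
    show |v.2| < (h : ℤ)
    omega
  have h6 : μ.real (Full n c ∩ _) ≤ _ := measureReal_mono
    (Set.subset_inter Set.inter_subset_left (full_inter_arms (Y := arc h 0 s t) (Y' := arc h 0 s' t') hU))
    (measure_ne_top μ _)
  refine le_trans ?_ (h4.trans h6)
  rw [mul_comm]
  exact mul_le_mul_of_nonneg_left (by linarith) measureReal_nonneg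

theorem dualFull_inter_crossing (hμ : IsBernoulliProduct (1 / 2) μ) {n h m : ℕ} (hn : n < h) {c : ℤ}
    (hc : |c| ≤ m)
    (hw : 1 - 1 / 4096 < μ.real (Arm (box n) (strip h) ((strip h)ᶜ ∩ wide m))) :
    μ.real (DualFull n c ∩ Arm (arc h 0 (-1) 1) (strip h) (arc h 0 1 (-1))) ≤
      1 / 4 * μ.real (Full n c) := by
  set B := Full n c ∩ Arm (arc h 0 1 1) (strip h) (arc h 0 (-1) (-1)) with hB
  have mF : MeasurableSet (Full n c) := measurableSet_cyl _ _
  have mB : MeasurableSet B := mF.inter (witnessed_arm _ _ _).measurableSet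
  have h1 := full_inter_crossing hμ hn hc hw (Or.inl rfl) (Or.inl rfl) (Or.inr rfl) (Or.inr rfl)
  have hsub : DualFull n c ∩ Arm (arc h 0 (-1) 1) (strip h) (arc h 0 1 (-1)) ⊆
      {ω | dual ω ∈ Full n c \ B} := by
    rintro ω ⟨h2, h3⟩
    rw [dualFull_eq] at h2
    exact ⟨h2, fun h4 => not_dual_crossing h3 h4.2⟩
  have h2 := measureReal_mono (μ := μ) hsub (measure_ne_top _ _)
  rw [real_dual hμ (mF.diff mB), measureReal_sdiff Set.inter_subset_left mB (measure_ne_top _ _)] at h2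
  linarith

end Half


section SecondMoment

variable {Ω : Type*} [MeasurableSpace Ω] {μ : Measure Ω}

theorem integral_indicator_mul {S T : Set Ω} (hS : MeasurableSet S) (hT : MeasurableSet T) :
    ∫ ω, S.indicator (1 : Ω → ℝ) ω * T.indicator (1 : Ω → ℝ) ω ∂μ = μ.real (S ∩ T) := by
  simp_rw [← Set.inter_indicator_mul, Pi.one_apply, mul_one]
  rw [integral_indicator_const _ (hS.inter hT), smul_eq_mul, mul_one]

variable [IsProbabilityMeasure μ]

theorem integrable_indicator_mul {S T : Set Ω} (hS : MeasurableSet S) (hT : MeasurableSet T) :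
    Integrable (fun ω => S.indicator (1 : Ω → ℝ) ω * T.indicator (1 : Ω → ℝ) ω) μ := by
  simp_rw [← Set.inter_indicator_mul, Pi.one_apply, mul_one]
  exact (integrable_const (1 : ℝ)).indicator (hS.inter hT)

/-- An event cannot be positively correlated with many independent events and negatively
correlated with as many others. -/
theorem card_mul_le_of_correlated {ι : Type*} [DecidableEq ι] (s : Finset ι) {O C : ι → Set Ω}
    {A : Set Ω} {r : ℝ}
    (mO : ∀ i, MeasurableSet (O i)) (mC : ∀ i, MeasurableSet (C i)) (mA : MeasurableSet A)
    (hO : ∀ i ∈ s, μ.real (O i) = r) (hC : ∀ i ∈ s, μ.real (C i) = r)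
    (hOO : ∀ i ∈ s, ∀ j ∈ s, i ≠ j → μ.real (O i ∩ O j) = r * r)
    (hOC : ∀ i ∈ s, ∀ j ∈ s, i ≠ j → μ.real (O i ∩ C j) = r * r)
    (hCO : ∀ i ∈ s, ∀ j ∈ s, i ≠ j → μ.real (C i ∩ O j) = r * r)
    (hCC : ∀ i ∈ s, ∀ j ∈ s, i ≠ j → μ.real (C i ∩ C j) = r * r)
    (hOA : ∀ i ∈ s, 3 / 4 * r ≤ μ.real (O i ∩ A)) (hCA : ∀ i ∈ s, μ.real (C i ∩ A) ≤ 1 / 4 * r) :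
    s.card * r ≤ 8 := by
  let I : Set Ω → Ω → ℝ := fun S => S.indicator 1
  let f : ι → Ω → ℝ := fun i ω => I (O i) ω - I (C i) ω
  have int : ∀ {S T}, MeasurableSet S → MeasurableSet T → Integrable (fun ω => I S ω * I T ω) μ :=
    integrable_indicator_mul
  have val : ∀ {S T}, MeasurableSet S → MeasurableSet T →
      ∫ ω, I S ω * I T ω ∂μ = μ.real (S ∩ T) := integral_indicator_mul
  have faint : ∀ i, Integrable (fun ω => f i ω * I A ω) μ := fun i => by
    simp only [f, sub_mul]
    exact (int (mO i) mA).sub (int (mC i) mA)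
  have faval : ∀ i ∈ s, r / 2 ≤ ∫ ω, f i ω * I A ω ∂μ := fun i hi => by
    simp only [f, sub_mul]
    rw [integral_sub (int (mO i) mA) (int (mC i) mA), val (mO i) mA, val (mC i) mA]
    linarith [hOA i hi, hCA i hi]
  have ffeq : ∀ i j ω, f i ω * f j ω = (I (O i) ω * I (O j) ω - I (O i) ω * I (C j) ω) -
      (I (C i) ω * I (O j) ω - I (C i) ω * I (C j) ω) := fun i j ω => by simp only [f]; ring
  have dint : ∀ {S : Set Ω}, MeasurableSet S → ∀ j,
      Integrable (fun ω => I S ω * I (O j) ω - I S ω * I (C j) ω) μ := fun hS j =>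
    (int hS (mO j)).sub (int hS (mC j))
  have ffint : ∀ i j, Integrable (fun ω => f i ω * f j ω) μ := fun i j => by
    simp only [ffeq]
    exact (dint (mO i) j).sub (dint (mC i) j)
  have ffval : ∀ i j, ∫ ω, f i ω * f j ω ∂μ = (μ.real (O i ∩ O j) - μ.real (O i ∩ C j)) -
      (μ.real (C i ∩ O j) - μ.real (C i ∩ C j)) := fun i j => by
    simp only [ffeq]
    rw [integral_sub (dint (mO i) j) (dint (mC i) j), integral_sub (int (mO i) (mO j))
      (int (mO i) (mC j)), integral_sub (int (mC i) (mO j)) (int (mC i) (mC j)),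
      val (mO i) (mO j), val (mO i) (mC j), val (mC i) (mO j), val (mC i) (mC j)]
  have ffle : ∀ i ∈ s, ∀ j ∈ s, ∫ ω, f i ω * f j ω ∂μ ≤ if i = j then 2 * r else 0 := by
    intro i hi j hj
    rw [ffval]
    split_ifs with h
    · subst h
      rw [Set.inter_self, Set.inter_self, hO i hi, hC i hi]
      linarith [measureReal_nonneg (μ := μ) (s := O i ∩ C i),
        measureReal_nonneg (μ := μ) (s := C i ∩ O i)]
    · rw [hOO i hi j hj h, hOC i hi j hj h, hCO i hi j hj h, hCC i hi j hj h]
      simp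
  have expand : ∀ ω, (I A ω - 1 / 4 * ∑ i ∈ s, f i ω) ^ 2 =
      I A ω * I A ω - 1 / 2 * ∑ i ∈ s, f i ω * I A ω +
        1 / 16 * ∑ i ∈ s, ∑ j ∈ s, f i ω * f j ω := fun ω => by
    rw [← Finset.sum_mul_sum, ← Finset.sum_mul]
    ring
  have i2 : Integrable (fun ω => 1 / 2 * ∑ i ∈ s, f i ω * I A ω) μ :=
    (integrable_finsetSum _ fun i _ => faint i).const_mul _
  have i3 : Integrable (fun ω => 1 / 16 * ∑ i ∈ s, ∑ j ∈ s, f i ω * f j ω) μ :=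
    (integrable_finsetSum _ fun i _ => integrable_finsetSum _ fun j _ => ffint i j).const_mul _
  have i1 : Integrable (fun ω => I A ω * I A ω - 1 / 2 * ∑ i ∈ s, f i ω * I A ω) μ :=
    (int mA mA).sub i2
  have h0 : 0 ≤ ∫ ω, (I A ω - 1 / 4 * ∑ i ∈ s, f i ω) ^ 2 ∂μ :=
    integral_nonneg fun ω => sq_nonneg _
  simp only [expand] at h0
  rw [integral_add i1 i3, integral_sub (int mA mA) i2, val mA mA, Set.inter_self,
    integral_const_mul, integral_const_mul, integral_finsetSum _ fun i _ => faint i,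
    integral_finsetSum _ fun i _ => integrable_finsetSum _ fun j _ => ffint i j] at h0
  simp only [integral_finsetSum _ fun j _ => ffint _ j] at h0
  have h1 : s.card * (r / 2) ≤ ∑ i ∈ s, ∫ ω, f i ω * I A ω ∂μ := by
    simpa using Finset.sum_le_sum faval
  have h2 : ∑ i ∈ s, ∑ j ∈ s, ∫ ω, f i ω * f j ω ∂μ ≤ s.card * (2 * r) := by
    refine (Finset.sum_le_sum fun i hi => Finset.sum_le_sum fun j hj => ffle i hi j hj).trans ?_
    rw [Finset.sum_congr rfl fun i hi => (Finset.sum_ite_eq s i _).trans (if_pos hi)]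
    simp
  have h3 : μ.real A ≤ 1 := measureReal_le_one
  linarith

end SecondMoment

theorem theta_half_eq_zero {μ : Measure PercConfig} [IsProbabilityMeasure μ]
    (hμ : IsBernoulliProduct (1 / 2) μ) : μ {ω | ClusterInfinite ω} = 0 := by
  by_contra hne
  obtain ⟨n, hn⟩ := exists_box_tall hμ hne (ε := 1 / 8192) (by norm_num)
  set r : ℝ := (1 / 2) ^ (boxEdges n 0).card with hr
  have hr0 : 0 < r := by positivity
  obtain ⟨L, hL⟩ := exists_nat_gt (8 / r)
  rw [div_lt_iff₀ hr0] at hL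
  obtain ⟨h, hh, hw⟩ := exists_wide_arm hμ (by norm_num) hn (L * (2 * n + 5)) (n + 1)
  norm_num at hw
  let c : ℕ → ℤ := fun i => i * (2 * n + 5)
  have hc : ∀ i ∈ Finset.range L, |c i| ≤ (L * (2 * n + 5) : ℕ) := by
    intro i hi
    have : (i : ℤ) ≤ L := by exact_mod_cast (Finset.mem_range.1 hi).le
    rw [abs_of_nonneg (by positivity)]
    push_cast
    exact mul_le_mul_of_nonneg_right this (by positivity)
  have hcol : ∀ i j, i ≠ j → column n (c j) ⊆ (column n (c i))ᶜ := by
    intro i j hij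
    refine column_disjoint ?_
    simp only [c]
    rw [← sub_mul, abs_mul, abs_of_nonneg (by positivity : (0 : ℤ) ≤ 2 * n + 5)]
    have : (1 : ℤ) ≤ |(i : ℤ) - j| := Int.one_le_abs (sub_ne_zero.2 (by exact_mod_cast hij))
    exact le_mul_of_one_le_left (by positivity) this
  have mF : ∀ i, MeasurableSet (Full n (c i)) := fun _ => measurableSet_cyl _ _
  have mD : ∀ i, MeasurableSet (DualFull n (c i)) := fun _ => measurableSet_cyl _ _
  have hF : ∀ i, μ.real (Full n (c i)) = r := fun i => real_full hμ n _
  have hD : ∀ i, μ.real (DualFull n (c i)) = r := fun i => real_dualFull hμ n _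
  have hcard := card_mul_le_of_correlated (μ := μ) (Finset.range L) (r := r) mF mD
    (witnessed_arm (arc h 0 (-1) 1) (strip h) (arc h 0 1 (-1))).measurableSet
    (fun i _ => hF i) (fun i _ => hD i)
    (fun i _ j _ hij => by
      rw [indep_of_depOn hμ (depOn_full n _) ((depOn_full n _).mono (hcol i j hij)) (mF i) (mF j),
        hF, hF])
    (fun i _ j _ hij => by
      rw [indep_of_depOn hμ (depOn_full n _) ((depOn_dualFull n _).mono (hcol i j hij)) (mF i)
        (mD j), hF, hD])
    (fun i _ j _ hij => by
      rw [indep_of_depOn hμ (depOn_dualFull n _) ((depOn_full n _).mono (hcol i j hij)) (mD i)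
        (mF j), hF, hD])
    (fun i _ j _ hij => by
      rw [indep_of_depOn hμ (depOn_dualFull n _) ((depOn_dualFull n _).mono (hcol i j hij)) (mD i)
        (mD j), hD, hD])
    (fun i hi => by
      rw [← hF i]
      exact full_inter_crossing hμ hh (hc i hi) (by norm_num; exact hw) (Or.inr rfl) (Or.inl rfl)
        (Or.inl rfl) (Or.inr rfl))
    (fun i hi => by
      rw [← hF i]
      exact dualFull_inter_crossing hμ hh (hc i hi) (by norm_num; exact hw))
  rw [Finset.card_range] at hcard
  linarith

theorem theta_eq_zero (P : ℝ → Measure PercConfig)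
    (hP : ∀ p ∈ Set.Ioo (0 : ℝ) 1, IsProbabilityMeasure (P p) ∧ IsBernoulliProduct p (P p))
    {p : ℝ} (hp : p ∈ Set.Ioo (0 : ℝ) 1) (h : p ≤ 1 / 2) : P p {ω | ClusterInfinite ω} = 0 := by
  have i1 := (hP p hp).1
  have i2 := (hP _ half_mem).1
  have heq : {ω | ClusterInfinite ω} = ⋂ N, Far N 0 := by
    ext ω; simp [clusterInfinite_iff]
  have hlim := tendsto_measure_iInter_atTop (μ := P (1 / 2))
    (fun N => (witnessed_far N 0).measurableSet.nullMeasurableSet) far_antitone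
    ⟨0, measure_ne_top _ _⟩
  rw [← heq, theta_half_eq_zero (hP _ half_mem).2] at hlim
  refine le_antisymm (ge_of_tendsto' hlim fun N => ?_) zero_le
  rw [heq]
  refine (measure_mono (Set.iInter_subset _ N)).trans ?_
  have h1 := real_far_mono hp half_mem h (hP p hp).2 (hP _ half_mem).2 N
  exact (ENNReal.toReal_le_toReal (measure_ne_top _ _) (measure_ne_top _ _)).1 h1

end Kesten

/-- **Kesten.** The critical probability of bond percolation on the square lattice `ℤ²`
equals one half: `p_c(ℤ²) = sup {p : θ(p) = 0} = 1/2`.  In particular `θ(p) > 0` for every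
`p > 1/2` and `θ(p) = 0` for every `p ≤ 1/2`. -/
theorem kesten_theorem
    (P : ℝ → Measure PercConfig)
    (hP : ∀ p ∈ Set.Ioo (0 : ℝ) 1,
      IsProbabilityMeasure (P p) ∧ IsBernoulliProduct p (P p)) :
    sSup {p ∈ Set.Ioo (0 : ℝ) 1 |
        P p {ω : PercConfig | ClusterInfinite ω} = 0} = 1 / 2 ∧
      (∀ p ∈ Set.Ioo (0 : ℝ) 1, 1 / 2 < p →
        0 < P p {ω : PercConfig | ClusterInfinite ω}) ∧
      (∀ p ∈ Set.Ioo (0 : ℝ) 1, p ≤ 1 / 2 →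
        P p {ω : PercConfig | ClusterInfinite ω} = 0) := by
  refine ⟨?_, fun p hp h => Kesten.theta_pos P hP hp h, fun p hp h => Kesten.theta_eq_zero P hP hp h⟩
  have : {p ∈ Set.Ioo (0 : ℝ) 1 | P p {ω : PercConfig | ClusterInfinite ω} = 0} =
      Set.Ioc 0 (1 / 2) := by
    ext p
    constructor
    · rintro ⟨hp, h0⟩
      exact ⟨hp.1, not_lt.1 fun h => (Kesten.theta_pos P hP hp h).ne' h0⟩
    · rintro ⟨h0, h1⟩
      have hp : p ∈ Set.Ioo (0 : ℝ) 1 := ⟨h0, by linarith⟩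
      exact ⟨hp, Kesten.theta_eq_zero P hP hp h1⟩
  rw [this, csSup_Ioc (by norm_num)]
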